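/- arXiv:math/9910087 — 10 statements merged into one kernel-verified Lean document; each statement's English description precedes it below -/
import Mathlib

section
/- Let n ≥ 2 be an integer and let B_{n,i} denote the number of permutations in S_n with exactly i cyclic descents. Then for every positive integer x, n·x^{n−1} = Σ_{i=1}^{n−1} B_{n,i} · C(n + x − i − 1, n − 1), where C(·,·) denotes the binomial coefficient. -/
/-- The number of descents of a permutation `w` of `Fin n`: positions `i` (0-based,
`i + 1 < n`) with `w (i+1) < w i`.  (In 1-based terms: `1 ≤ i ≤ n-1` with `w(i) > w(i+1)`.) -/
def numDescents {n : ℕ} (w : Equiv.Perm (Fin n)) : ℕ :=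
  (Finset.univ.filter (fun i : Fin n => (i : ℕ) + 1 < n ∧ w (finRotate n i) < w i)).card

/-- The number of cyclic descents of `w`: `numDescents w + 1` if `w(n) > w(1)`
(i.e. `w (n-1) > w 0` in 0-based terms), and `numDescents w` otherwise.  Equivalently,
the number of `i : Fin n` with `w (i+1) < w i`, where `i + 1` is taken cyclically. -/
def numCyclicDescents {n : ℕ} (w : Equiv.Perm (Fin n)) : ℕ :=
  (Finset.univ.filter (fun i : Fin n => w (finRotate n i) < w i)).card

/-- `B_{n,i}`, the number of permutations of `Sₙ` with exactly `i` cyclic descents. -/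
def B (n i : ℕ) : ℕ :=
  (Finset.univ.filter (fun w : Equiv.Perm (Fin n) => numCyclicDescents w = i)).card

open Finset in
theorem aux_strict (k N : ℕ) :
    (univ.filter (fun h : Fin k → Fin N => StrictMono h)).card = N.choose k := by
  rw [← Fintype.card_subtype]
  have e : {h : Fin k → Fin N // StrictMono h} ≃ (Fin k ↪o Fin N) :=
    { toFun := fun h => OrderEmbedding.ofStrictMono h.1 h.2
      invFun := fun f => ⟨f, f.strictMono⟩
      left_inv := fun h => rfl
      right_inv := fun f => rfl }
  rw [← Nat.card_eq_fintype_card, Nat.card_congr (e.trans Set.powersetCard.ofFinEmbEquiv),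
    Set.powersetCard.card, Nat.card_eq_fintype_card, Fintype.card_fin]

open Finset in
theorem aux_count (M x : ℕ) (P : Fin M → Prop) [DecidablePred P] :
    (univ.filter (fun g : Fin (M+1) → Fin x =>
      ∀ i : Fin M, (g i.castSucc : ℕ) + (if P i then 1 else 0) ≤ g i.succ)).card
    = (M + x - (univ.filter P).card).choose (M+1) := by
  rw [← aux_strict]
  set D := (univ.filter P).card with hD
  let S : Fin (M+1) → ℕ := fun i => (univ.filter (fun j : Fin M => j.castSucc < i ∧ ¬ P j)).card
  have S0 : S 0 = 0 := by simp [S]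
  have SS : ∀ i : Fin M, S i.succ = S i.castSucc + (if P i then 0 else 1) := by
    intro i
    simp only [S]
    split_ifs with h
    · rw [add_zero]
      congr 1
      ext j
      simp only [mem_filter, mem_univ, true_and, Fin.castSucc_lt_succ_iff, Fin.castSucc_lt_castSucc_iff]
      constructor
      · rintro ⟨h1, h2⟩
        exact ⟨lt_of_le_of_ne h1 (fun h3 => h2 (h3 ▸ h)), h2⟩
      · rintro ⟨h1, h2⟩
        exact ⟨h1.le, h2⟩
    · rw [← card_insert_of_notMem (a := i) (by simp)]
      congr 1
      ext j
      simp only [mem_filter, mem_insert, mem_univ, true_and, Fin.castSucc_lt_succ_iff, Fin.castSucc_lt_castSucc_iff]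
      constructor
      · rintro ⟨h1, h2⟩
        rcases h1.eq_or_lt with h3 | h3
        · exact Or.inl h3
        · exact Or.inr ⟨h3, h2⟩
      · rintro (h1 | ⟨h1, h2⟩)
        · subst h1; exact ⟨le_rfl, h⟩
        · exact ⟨h1.le, h2⟩
  have SL : S (Fin.last M) + D = M := by
    have := card_filter_add_card_filter_not (s := (univ : Finset (Fin M))) P
    simp only [S, hD, Fin.castSucc_lt_last, true_and]
    simp at this
    omega
  have Smono : Monotone S := by
    rw [Fin.monotone_iff_le_succ]
    intro i
    rw [SS]; omega
  have SD : ∀ i, S i + D ≤ M := fun i => by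
    have := Smono (Fin.le_last i)
    omega
  refine card_bij (fun g _ k => ⟨g k + S k, by have := SD k; have := (g k).2; omega⟩) ?_ ?_ ?_
  · intro g hg
    simp only [mem_filter, mem_univ, true_and] at hg ⊢
    rw [Fin.strictMono_iff_lt_succ]
    intro i
    have h1 := hg i
    have h2 := SS i
    rw [Fin.lt_def]
    simp only
    split_ifs at h1 h2 <;> omega
  · intro g _ g' _ h
    funext k
    have := congrFun h k
    simp only [Fin.mk.injEq] at this
    ext
    omega
  · intro h hh
    simp only [mem_filter, mem_univ, true_and] at hh
    have tm : Monotone (fun i => ((h i : ℕ) : ℤ) - S i) := by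
      rw [Fin.monotone_iff_le_succ]
      intro i
      have h1 := SS i
      have h2 : (h i.castSucc : ℕ) < h i.succ := hh (Fin.castSucc_lt_succ)
      split_ifs at h1 <;> omega
    have lo : ∀ i, S i ≤ h i := by
      intro i
      have := tm (Fin.zero_le i)
      simp only [S0] at this
      omega
    have hi : ∀ i, (h i : ℕ) - S i < x := by
      intro i
      have := tm (Fin.le_last i)
      simp only at this
      have := (h (Fin.last M)).2
      have := lo i
      omega
    refine ⟨fun i => ⟨h i - S i, hi i⟩, ?_, ?_⟩
    · simp only [mem_filter, mem_univ, true_and]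
      intro i
      have h1 := SS i
      have h2 : (h i.castSucc : ℕ) < h i.succ := hh (Fin.castSucc_lt_succ)
      have := lo i.succ
      have := lo i.castSucc
      split_ifs at h1 ⊢ <;> omega
    · funext k
      ext
      have := lo k
      simp only
      omega

def desc' {M : ℕ} (e : Equiv.Perm (Fin (M+1))) : ℕ :=
  (Finset.univ.filter (fun i : Fin M => e i.succ < e i.castSucc)).card

open Finset in
theorem aux_fiber (M x : ℕ) (e : Equiv.Perm (Fin (M+1))) :
    (univ.filter (fun f : Fin (M+1) → Fin x => Tuple.sort f = e)).card
      = (M + x - desc' e).choose (M+1) := by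
  rw [desc', ← aux_count]
  refine card_equiv (Equiv.arrowCongr e.symm (Equiv.refl _)) ?_
  intro f
  simp only [mem_filter, mem_univ, true_and]
  rw [eq_comm, Tuple.eq_sort_iff]
  have key : ∀ k, (Equiv.arrowCongr e.symm (Equiv.refl (Fin x))) f k = f (e k) := by
    intro k; simp [Equiv.arrowCongr]
  simp only [key]
  constructor
  · rintro ⟨h1, h2⟩ i
    have h3 : f (e i.castSucc) ≤ f (e i.succ) := h1 Fin.castSucc_lt_succ.le
    split_ifs with h
    · have : f (e i.castSucc) < f (e i.succ) :=
        lt_of_le_of_ne h3 fun h4 => absurd (h2 _ _ Fin.castSucc_lt_succ h4) h.le.not_gt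
      exact this
    · exact h3
  · intro h
    have hm : Monotone (f ∘ e) := by
      rw [Fin.monotone_iff_le_succ]
      intro i
      have := h i
      exact (Nat.le_add_right _ _).trans this
    refine ⟨hm, ?_⟩
    intro i j hij hf
    -- lexicographic strict monotonicity
    have hs : StrictMono (fun k => toLex (f (e k), e k)) := by
      rw [Fin.strictMono_iff_lt_succ]
      intro k
      rw [Prod.Lex.toLex_lt_toLex]
      have h1 := h k
      have h2 : f (e k.castSucc) ≤ f (e k.succ) := hm Fin.castSucc_lt_succ.le
      rcases h2.lt_or_eq with h3 | h3
      · exact Or.inl h3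
      · refine Or.inr ⟨h3, ?_⟩
        split_ifs at h1 with h4
        · rw [h3] at h1; omega
        · refine lt_of_le_of_ne (not_lt.1 h4) fun h5 => ?_
          exact Fin.castSucc_lt_succ.ne (e.injective h5)
    have := hs hij
    rw [Prod.Lex.toLex_lt_toLex] at this
    rcases this with h1 | h1
    · exact absurd hf h1.ne
    · exact h1.2

open Finset in
theorem aux_worp (M x : ℕ) :
    x ^ (M+1) = ∑ e : Equiv.Perm (Fin (M+1)), (M + x - desc' e).choose (M+1) := by
  have := card_eq_sum_card_fiberwise (s := (univ : Finset (Fin (M+1) → Fin x)))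
    (f := fun f => Tuple.sort f) (t := univ) (fun _ _ => by simp)
  simp only [aux_fiber] at this
  rw [← this]
  simp

def auxMap {M : ℕ} (p : Fin (M+2) × Equiv.Perm (Fin (M+1))) : Equiv.Perm (Fin (M+2)) :=
  (Equiv.addRight p.1).trans (Equiv.Perm.decomposeFin.symm (0, p.2))

theorem auxMap_bij {M : ℕ} : Function.Bijective (auxMap (M := M)) := by
  rw [Fintype.bijective_iff_injective_and_card]
  constructor
  · rintro ⟨k, e⟩ ⟨k', e'⟩ h
    have h0 := Equiv.congr_fun h (-k)
    simp only [auxMap, Equiv.trans_apply, Equiv.coe_addRight, neg_add_cancel,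
      Equiv.Perm.decomposeFin_symm_apply_zero] at h0
    have h1 : -k + k' = 0 := by
      apply (Equiv.Perm.decomposeFin.symm (0, e')).injective
      rw [← h0, Equiv.Perm.decomposeFin_symm_apply_zero]
    have h2 : k = k' := by
      rw [neg_add_eq_zero] at h1; exact h1
    subst h2
    have h3 : Equiv.Perm.decomposeFin.symm ((0 : Fin (M+2)), e) = Equiv.Perm.decomposeFin.symm (0, e') := by
      ext i
      have := Equiv.congr_fun h (i - k)
      simp only [auxMap, Equiv.trans_apply, Equiv.coe_addRight, sub_add_cancel] at this
      rw [this]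
    have := Equiv.Perm.decomposeFin.symm.injective h3
    simp at this
    rw [this]
  · simp [Fintype.card_perm, Nat.factorial_succ]

open Finset in
theorem auxMap_cd {M : ℕ} (k : Fin (M+2)) (e : Equiv.Perm (Fin (M+1))) :
    numCyclicDescents (auxMap (k, e)) = desc' e + 1 := by
  have h1 : numCyclicDescents (auxMap (k, e))
      = numCyclicDescents (Equiv.Perm.decomposeFin.symm ((0 : Fin (M+2)), e)) := by
    unfold numCyclicDescents
    refine card_equiv (Equiv.addRight k) ?_
    intro i
    simp only [mem_filter, mem_univ, true_and, auxMap, Equiv.trans_apply, Equiv.coe_addRight,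
      finRotate_succ_apply]
    rw [add_right_comm]
  rw [h1]
  unfold numCyclicDescents desc'
  simp only [card_filter, finRotate_succ_apply]
  rw [Fin.sum_univ_succ, Fin.sum_univ_castSucc]
  have hl : (Fin.last M).succ + 1 = (0 : Fin (M+2)) := by
    rw [Fin.succ_last, Fin.last_add_one]
  have hc : ∀ i : Fin M, i.castSucc.succ + 1 = i.succ.succ := by
    intro i
    rw [Fin.succ_castSucc, Fin.coeSucc_eq_succ]
  simp only [hl, hc, Equiv.Perm.decomposeFin_symm_apply_zero, Equiv.Perm.decomposeFin_symm_apply_succ,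
    Equiv.swap_self, Equiv.refl_apply, Fin.succ_lt_succ_iff, Fin.succ_pos, if_true, Fin.not_lt_zero, if_false, zero_add]

/-- For `n ≥ 2` and every positive integer `x`,
`n·x^{n-1} = Σ_{i=1}^{n-1} B_{n,i} · C(n + x - i - 1, n - 1)`. -/
theorem worpitzky_cyclic (n : ℕ) (hn : 2 ≤ n) (x : ℕ) (hx : 1 ≤ x) :
    n * x ^ (n - 1)
      = ∑ i ∈ Finset.Icc 1 (n - 1), B n i * Nat.choose (n + x - i - 1) (n - 1) := by
  obtain ⟨M, rfl⟩ : ∃ M, n = M + 2 := ⟨n - 2, by omega⟩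
  have hr : ∀ w : Equiv.Perm (Fin (M+2)), numCyclicDescents w ∈ Finset.Icc 1 (M + 2 - 1) := by
    intro w
    obtain ⟨⟨k, e⟩, rfl⟩ := auxMap_bij.2 w
    rw [auxMap_cd]
    have : desc' e ≤ M := by
      unfold desc'
      exact (Finset.card_le_univ _).trans (by simp)
    simp
    omega
  have h1 : ∑ i ∈ Finset.Icc 1 (M + 2 - 1), B (M+2) i * Nat.choose (M + 2 + x - i - 1) (M + 2 - 1)
      = ∑ w : Equiv.Perm (Fin (M+2)),
        Nat.choose (M + 2 + x - numCyclicDescents w - 1) (M + 2 - 1) := by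
    rw [← Finset.sum_fiberwise_of_maps_to (g := numCyclicDescents) (fun w _ => hr w)]
    refine Finset.sum_congr rfl fun i _ => ?_
    rw [Finset.sum_congr rfl (g := fun _ => Nat.choose (M + 2 + x - i - 1) (M + 2 - 1))]
    · rw [Finset.sum_const, smul_eq_mul, B]
    · intro w hw
      rw [(Finset.mem_filter.1 hw).2]
  rw [h1, ← auxMap_bij.sum_comp, Fintype.sum_prod_type]
  simp only [auxMap_cd]
  rw [Finset.sum_const, Finset.card_univ, Fintype.card_fin, smul_eq_mul]
  congr 1
  have h2 := aux_worp M x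
  rw [show M + 2 - 1 = M + 1 by omega, h2]
  refine Finset.sum_congr rfl fun e _ => ?_
  congr 1
  omega
end

section
/- Let n ≥ 2 be an integer. Let B_{n,i} denote the number of permutations in S_n with exactly i cyclic descents, and let A_{n−1,i} denote the number of permutations in S_{n−1} with exactly i − 1 descents. Then for every i, B_{n,i} = n · A_{n−1,i}. -/
/-- `A_{m,i}`, the number of permutations of `S_m` with exactly `i - 1` descents
(expressed as `numDescents w + 1 = i` to avoid natural subtraction). -/
def A (m i : ℕ) : ℕ :=
  (Finset.univ.filter (fun w : Equiv.Perm (Fin m) => numDescents w + 1 = i)).card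

def extP {m : ℕ} (v : Equiv.Perm (Fin m)) : Equiv.Perm (Fin (m + 1)) :=
  finSuccEquivLast.symm.permCongr (Equiv.optionCongr v)

theorem extP_castSucc {m : ℕ} (v : Equiv.Perm (Fin m)) (i : Fin m) :
    extP v i.castSucc = (v i).castSucc := by
  simp [extP, Equiv.permCongr_apply]

theorem extP_last {m : ℕ} (v : Equiv.Perm (Fin m)) :
    extP v (Fin.last m) = Fin.last m := by
  simp [extP, Equiv.permCongr_apply]

theorem cd_extP {m : ℕ} (hm : 1 ≤ m) (v : Equiv.Perm (Fin m)) :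
    numCyclicDescents (extP v) = numDescents v + 1 := by
  obtain ⟨p, rfl⟩ : ∃ p, m = p + 1 := ⟨m - 1, by omega⟩
  unfold numCyclicDescents numDescents
  rw [Finset.card_filter, Finset.card_filter, Fin.sum_univ_castSucc]
  congr 1
  · refine Finset.sum_congr rfl fun i _ => ?_
    congr 1
    apply propext
    rw [finRotate_succ_apply, finRotate_succ_apply, extP_castSucc]
    induction i using Fin.lastCases with
    | last =>
      have : (Fin.last p).castSucc + 1 = Fin.last (p + 1) := by
        simp
      rw [this, extP_last]
      simp [Fin.le_last]
    | cast j =>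
      have h1 : (j.castSucc).castSucc + 1 = (j.castSucc + 1).castSucc := by
        simp
      rw [h1, extP_castSucc, Fin.castSucc_lt_castSucc_iff]
      simp
  · rw [finRotate_last, extP_last, if_pos]
    have : (0 : Fin (p + 1 + 1)) = (0 : Fin (p + 1)).castSucc := rfl
    rw [this, extP_castSucc]
    exact Fin.castSucc_lt_last _

def rotP {m : ℕ} (x : Fin (m + 1) × Equiv.Perm (Fin m)) : Equiv.Perm (Fin (m + 1)) :=
  (Equiv.addRight x.1).trans (extP x.2)

theorem rotP_apply {m : ℕ} (x : Fin (m + 1) × Equiv.Perm (Fin m)) (j : Fin (m + 1)) :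
    rotP x j = extP x.2 (j + x.1) := rfl

theorem cd_rotP {m : ℕ} (x : Fin (m + 1) × Equiv.Perm (Fin m)) :
    numCyclicDescents (rotP x) = numCyclicDescents (extP x.2) := by
  unfold numCyclicDescents
  rw [Finset.card_filter, Finset.card_filter]
  refine Fintype.sum_equiv (Equiv.addRight x.1) _ _ fun j => ?_
  simp only [rotP_apply, finRotate_succ_apply, Equiv.coe_addRight]
  rw [add_right_comm]

theorem rotP_bij {m : ℕ} : Function.Bijective (rotP (m := m)) := by
  rw [Fintype.bijective_iff_injective_and_card]
  constructor
  · rintro ⟨k, v⟩ ⟨k', v'⟩ h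
    have h1 := congrArg (fun f => f (Fin.last m - k)) h
    simp only [rotP_apply, sub_add_cancel, extP_last] at h1
    have h2 : Fin.last m - k + k' = Fin.last m := by
      apply (extP v').injective
      rw [← h1, extP_last]
    have hk : k = k' := by
      have h3 : Fin.last m - k + k' = Fin.last m - k + k := by rw [h2, sub_add_cancel]
      exact (add_left_cancel h3).symm
    subst hk
    congr 1
    ext1 j
    have h4 := congrArg (fun f => f (j.castSucc - k)) h
    simp only [rotP_apply, sub_add_cancel, extP_castSucc] at h4
    exact Fin.castSucc_injective _ h4
  · simp [Fintype.card_perm, Nat.factorial_succ]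

/-- For `n ≥ 2` and every `i`, `B_{n,i} = n · A_{n-1,i}`. -/
theorem cyclicDescent_count_eq (n : ℕ) (hn : 2 ≤ n) (i : ℕ) :
    B n i = n * A (n - 1) i := by
  obtain ⟨m, rfl⟩ : ∃ m, n = m + 1 := ⟨n - 1, by omega⟩
  have hm : 1 ≤ m := by omega
  unfold B A
  rw [Nat.add_sub_cancel]
  have e : (Finset.univ ×ˢ Finset.univ.filter
      (fun w : Equiv.Perm (Fin m) => numDescents w + 1 = i) :
      Finset (Fin (m + 1) × Equiv.Perm (Fin m))).card = (m + 1) * (Finset.univ.filter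
      (fun w : Equiv.Perm (Fin m) => numDescents w + 1 = i)).card := by
    rw [Finset.card_product, Finset.card_univ, Fintype.card_fin]
  rw [← e]
  symm
  refine Finset.card_equiv (Equiv.ofBijective rotP rotP_bij) fun x => ?_
  simp [cd_rotP, cd_extP hm]
end

section
/- Let n ≥ 1 and k ≥ 1 be integers, let s be the k-riffle shuffle element and c the cut element of ℚ[S_n]. Then c·s·c = c·s in the group algebra ℚ[S_n]. -/
/-- The `k`-riffle shuffle element of the rational group algebra `ℚ[Sₙ]`:
`s = (1/kⁿ) Σ_w C(n + k - d(w⁻¹) - 1, n) · w`. -/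
noncomputable def riffleElt (n k : ℕ) : MonoidAlgebra ℚ (Equiv.Perm (Fin n)) :=
  ∑ w : Equiv.Perm (Fin n),
    MonoidAlgebra.single w
      ((1 / (k : ℚ) ^ n) * (Nat.choose (n + k - numDescents w⁻¹ - 1) n : ℚ))

/-- The cut element of `ℚ[Sₙ]`: `c = (1/n) Σ_{i=0}^{n-1} ζ^i` where `ζ = (1 2 ⋯ n)`. -/
noncomputable def cutElt (n : ℕ) : MonoidAlgebra ℚ (Equiv.Perm (Fin n)) :=
  ∑ i ∈ Finset.range n, MonoidAlgebra.single (finRotate n ^ i) (1 / (n : ℚ))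

namespace CutRiffle

open Fin.NatCast

def cd {m : ℕ} (v : Equiv.Perm (Fin (m+1))) : ℕ :=
  ∑ i, if v (i + 1) < v i then 1 else 0

lemma rot_pow {m : ℕ} (i : ℕ) (x : Fin (m+1)) : (finRotate (m+1) ^ i) x = x + (i : Fin (m+1)) := by
  induction i generalizing x with
  | zero => simp
  | succ i ih =>
    rw [pow_succ, Equiv.Perm.mul_apply, ih, finRotate_apply]
    ext
    simp [Fin.val_add]
    congr 1
    ring

lemma nd_eq {m : ℕ} (w : Equiv.Perm (Fin (m+1))) :
    numDescents w + (if w 0 < w (Fin.last m) then 1 else 0) = cd w := by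
  unfold numDescents cd
  rw [Finset.card_filter, Fin.sum_univ_castSucc, Fin.sum_univ_castSucc]
  simp

lemma cd_rot {m : ℕ} (v : Equiv.Perm (Fin (m+1))) (i : ℕ) :
    cd (v * finRotate (m+1) ^ i) = cd v := by
  unfold cd
  simp only [Equiv.Perm.mul_apply, rot_pow]
  rw [← Equiv.sum_comp (Equiv.addRight (i : Fin (m+1)))
    (fun j => if v (j + 1) < v j then (1 : ℕ) else 0)]
  simp only [Equiv.coe_addRight]
  refine Finset.sum_congr rfl fun j _ => ?_
  rw [add_right_comm]
  rfl

lemma key {m : ℕ} (a b : Fin (m+1)) :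
    (if finRotate (m+1) a < finRotate (m+1) b then 1 else 0) + (if b = Fin.last m then 1 else 0)
      = (if a < b then 1 else 0) + (if a = Fin.last m then 1 else 0) := by
  have ha := coe_finRotate a
  have hb := coe_finRotate b
  have := a.2
  have := b.2
  simp only [Fin.lt_def, ha, hb]
  simp only [Fin.ext_iff, Fin.val_last]
  grind

lemma cd_left {m : ℕ} (v : Equiv.Perm (Fin (m+1))) :
    cd (finRotate (m+1) * v) = cd v := by
  have h : ∑ i, ((if finRotate (m+1) (v (i+1)) < finRotate (m+1) (v i) then 1 else 0)
      + (if v i = Fin.last m then 1 else 0))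
      = ∑ i, ((if v (i+1) < v i then 1 else 0) + (if v (i+1) = Fin.last m then 1 else 0)) :=
    Finset.sum_congr rfl fun i _ => key _ _
  rw [Finset.sum_add_distrib, Finset.sum_add_distrib] at h
  have h2 := Equiv.sum_comp (Equiv.addRight (1 : Fin (m+1)))
    (fun j => if v j = Fin.last m then (1 : ℕ) else 0)
  simp only [Equiv.coe_addRight] at h2
  erw [h2] at h
  exact Nat.add_right_cancel h

lemma sum_rot {m : ℕ} (f : ℕ → ℚ) (v : Equiv.Perm (Fin (m+1))) :
    ∑ i ∈ Finset.range (m+1), f (numDescents (v * finRotate (m+1) ^ (i : ℕ))) =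
      (cd v : ℚ) * f (cd v - 1) + ((m : ℚ) + 1 - cd v) * f (cd v) := by
  have h1 : ∀ i : ℕ, f (numDescents (v * finRotate (m+1) ^ i)) =
      (fun j => f (cd v - if v (j + 1) < v j then 1 else 0)) (Fin.last m + (i : Fin (m+1))) := by
    intro i
    have h := nd_eq (v * finRotate (m+1) ^ i)
    rw [cd_rot] at h
    simp only [Equiv.Perm.mul_apply, rot_pow] at h
    have h0 : Fin.last m + (i : Fin (m+1)) + 1 = 0 + (i : Fin (m+1)) := by
      rw [add_right_comm]; simp
    simp only [h0]
    congr 1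
    omega
  simp only [h1]
  rw [Finset.sum_range (fun i : ℕ => f (cd v - if v ((Fin.last m + (i : Fin (m+1))) + 1) < v (Fin.last m + (i : Fin (m+1))) then 1 else 0))]
  simp only [Fin.cast_val_eq_self]
  have h2 := Equiv.sum_comp (Equiv.addLeft (Fin.last m))
    (fun j => f (cd v - if v (j + 1) < v j then 1 else 0))
  simp only [Equiv.coe_addLeft] at h2
  refine Eq.trans h2 ?_
  have h3 : ∀ j, f (cd v - if v (j + 1) < v j then 1 else 0) =
     ((if v (j + 1) < v j then 1 else 0 : ℕ) : ℚ) * (f (cd v - 1) - f (cd v)) + f (cd v) := by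
    intro j; split_ifs <;> simp
  simp only [h3]
  rw [Finset.sum_add_distrib, ← Finset.sum_mul, ← Nat.cast_sum]
  change (cd v : ℚ) * _ + _ = _
  simp
  ring

lemma riffle_coeff (n k : ℕ) (u : Equiv.Perm (Fin n)) :
    (riffleElt n k).coeff u =
      (1 / (k : ℚ) ^ n) * (Nat.choose (n + k - numDescents u⁻¹ - 1) n : ℚ) := by
  unfold riffleElt
  simp [Finsupp.single_apply]

lemma cs_rot (m k : ℕ) :
    cutElt (m+1) * riffleElt (m+1) k * MonoidAlgebra.single (finRotate (m+1)) 1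
      = cutElt (m+1) * riffleElt (m+1) k := by
  have hc : ∀ u, (cutElt (m+1) * riffleElt (m+1) k).coeff u =
      1 / ((m+1 : ℕ) : ℚ) * ∑ i ∈ Finset.range (m+1),
        (fun d => (1 / (k : ℚ) ^ (m+1)) * (Nat.choose (m+1 + k - d - 1) (m+1) : ℚ))
          (numDescents (u⁻¹ * finRotate (m+1) ^ i)) := by
    intro u
    unfold cutElt
    rw [Finset.sum_mul, Finset.mul_sum]
    simp [riffle_coeff]
  ext u
  rw [MonoidAlgebra.coeff_mul_single_apply, hc, hc,
    sum_rot (fun d => (1 / (k : ℚ) ^ (m+1)) * (Nat.choose (m+1 + k - d - 1) (m+1) : ℚ)),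
    sum_rot (fun d => (1 / (k : ℚ) ^ (m+1)) * (Nat.choose (m+1 + k - d - 1) (m+1) : ℚ)),
    mul_inv_rev, inv_inv, cd_left, mul_one]

end CutRiffle

theorem cut_riffle_cut (n k : ℕ) (hn : 1 ≤ n) (hk : 1 ≤ k) :
    cutElt n * riffleElt n k * cutElt n = cutElt n * riffleElt n k := by
  obtain ⟨m, rfl⟩ : ∃ m, n = m + 1 := ⟨n - 1, by omega⟩
  have hp : ∀ i : ℕ, cutElt (m+1) * riffleElt (m+1) k *
      MonoidAlgebra.single (finRotate (m+1) ^ i) (1 : ℚ) = cutElt (m+1) * riffleElt (m+1) k := by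
    intro i
    induction i with
    | zero => rw [pow_zero, ← MonoidAlgebra.one_def, mul_one]
    | succ i ih =>
      have : MonoidAlgebra.single (finRotate (m+1) ^ (i+1)) (1 : ℚ) =
        MonoidAlgebra.single (finRotate (m+1) ^ i) 1 * MonoidAlgebra.single (finRotate (m+1)) 1 := by
        rw [MonoidAlgebra.single_mul_single, pow_succ, mul_one]
      rw [this, ← mul_assoc, ih, CutRiffle.cs_rot]
  have hcut : cutElt (m+1) = (1 / ((m+1 : ℕ) : ℚ)) •
      ∑ i ∈ Finset.range (m+1), MonoidAlgebra.single (finRotate (m+1) ^ i) (1 : ℚ) := by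
    unfold cutElt
    rw [Finset.smul_sum]
    refine Finset.sum_congr rfl fun i _ => ?_
    rw [MonoidAlgebra.smul_single, smul_eq_mul, mul_one]
  generalize hx : cutElt (m+1) * riffleElt (m+1) k = x at *
  rw [hcut, mul_smul_comm, Finset.mul_sum, Finset.sum_congr rfl (fun i _ => hp i)]
  rw [Finset.sum_const, Finset.card_range, ← Nat.cast_smul_eq_nsmul ℚ, smul_smul]
  rw [one_div, inv_mul_cancel₀ (by positivity), one_smul]
end

section
/- Let n ≥ 1 and k ≥ 1 be integers. Let S^{(k)} be the k-riffle shuffle probability measure on S_n, C the cut measure, and U the uniform distribution on S_n. Then ‖C∗S^{(k)} − U‖ ≤ ‖S^{(k)}∗C − U‖; that is, a riffle shuffle followed by a cut is at least as close to uniform as a cut followed by a riffle shuffle. -/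
/-- The `k`-riffle shuffle probability measure on `Sₙ`:
`S⁽ᵏ⁾(w) = (1/kⁿ) C(n + k - d(w⁻¹) - 1, n)`. -/
noncomputable def riffleMeasure (n k : ℕ) (w : Equiv.Perm (Fin n)) : ℝ :=
  (1 / (k : ℝ) ^ n) * (Nat.choose (n + k - numDescents w⁻¹ - 1) n : ℝ)

/-- The cut measure on `Sₙ`: probability `1/n` on each power `ζ^i`, `0 ≤ i ≤ n-1`,
of the `n`-cycle `ζ = (1 2 ⋯ n)`, and `0` elsewhere. -/
noncomputable def cutMeasure (n : ℕ) (w : Equiv.Perm (Fin n)) : ℝ :=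
  (((Finset.range n).filter (fun i => finRotate n ^ i = w)).card : ℝ) / (n : ℝ)

/-- The convolution of two measures on a finite group: `(P∗Q)(π) = Σ_τ P(π τ⁻¹) Q(τ)`. -/
noncomputable def convMeasure {G : Type*} [Group G] [Fintype G] (P Q : G → ℝ) : G → ℝ :=
  fun g => ∑ τ : G, P (g * τ⁻¹) * Q τ

/-- The total variation distance between two measures on a finite set. -/
noncomputable def tvDist {X : Type*} [Fintype X] (P₁ P₂ : X → ℝ) : ℝ :=
  (1 / 2) * ∑ x : X, |P₁ x - P₂ x|


/-- cyclic descents -/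
def cycDes {m : ℕ} (u : Equiv.Perm (Fin (m+1))) : ℕ :=
  ∑ i : Fin (m+1), if u (finRotate (m+1) i) < u i then 1 else 0

theorem cycDes_rot_right {m : ℕ} (u : Equiv.Perm (Fin (m+1))) (i : ℕ) :
    cycDes (u * finRotate (m+1) ^ i) = cycDes u := by
  unfold cycDes
  rw [← Equiv.sum_comp (finRotate (m+1) ^ i)
    (fun x => if u (finRotate (m+1) x) < u x then 1 else 0)]
  refine Finset.sum_congr rfl fun x _ => ?_
  have : (finRotate (m+1) ^ i) (finRotate (m+1) x) = finRotate (m+1) ((finRotate (m+1) ^ i) x) := by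
    rw [← Equiv.Perm.mul_apply, ← Equiv.Perm.mul_apply, ← pow_succ, ← pow_succ']
  simp only [Equiv.Perm.mul_apply, this]

theorem rot_lt {m : ℕ} (a b : Fin (m+1)) :
    (if finRotate (m+1) a < finRotate (m+1) b then 1 else 0) + (if b = Fin.last m then 1 else 0)
     = (if a < b then 1 else 0) + (if a = Fin.last m then 1 else 0) := by
  have ha := a.2
  have hb := b.2
  simp only [Fin.lt_def, coe_finRotate]
  simp only [Fin.ext_iff, Fin.val_last]
  split_ifs <;> omega

theorem cycDes_rot_left {m : ℕ} (u : Equiv.Perm (Fin (m+1))) :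
    cycDes (finRotate (m+1) * u) = cycDes u := by
  have h := Finset.sum_congr (rfl : (Finset.univ : Finset (Fin (m+1))) = Finset.univ)
    fun x _ => rot_lt (u (finRotate (m+1) x)) (u x)
  rw [Finset.sum_add_distrib, Finset.sum_add_distrib,
    Equiv.sum_comp (finRotate (m+1)) (fun x => if u x = Fin.last m then 1 else 0)] at h
  exact Nat.add_right_cancel h

theorem numDescents_eq {m : ℕ} (u : Equiv.Perm (Fin (m+1))) :
    numDescents u = cycDes u -
      (if u (finRotate (m+1) (Fin.last m)) < u (Fin.last m) then 1 else 0) := by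
  unfold numDescents cycDes
  rw [Finset.card_filter, Fin.sum_univ_castSucc, Fin.sum_univ_castSucc]
  simp

theorem rot_pow {m : ℕ} (i : ℕ) (x : Fin (m+1)) :
    (finRotate (m+1) ^ i) x = x + Fin.ofNat (m+1) i := by
  induction i with
  | zero => simp
  | succ i ih =>
    rw [pow_succ', Equiv.Perm.mul_apply, ih, finRotate_apply, add_assoc]
    congr 1
    apply Fin.ext
    simp [Fin.val_add]

theorem sum_rot {m : ℕ} (F : ℕ → ℝ) (u : Equiv.Perm (Fin (m+1))) :
    ∑ i ∈ Finset.range (m+1), F (numDescents (u * finRotate (m+1) ^ i)) =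
      (cycDes u) * F (cycDes u - 1) + (m + 1 - cycDes u) * F (cycDes u) := by
  have h1 : ∀ i : ℕ, F (numDescents (u * finRotate (m+1) ^ i)) =
      (fun x => F (cycDes u - (if u (finRotate (m+1) x) < u x then 1 else 0)))
        (Fin.last m + Fin.ofNat (m+1) i) := by
    intro i
    rw [numDescents_eq, cycDes_rot_right]
    have : (finRotate (m+1) ^ i) (finRotate (m+1) (Fin.last m))
        = finRotate (m+1) ((finRotate (m+1) ^ i) (Fin.last m)) := by
      rw [← Equiv.Perm.mul_apply, ← Equiv.Perm.mul_apply, ← pow_succ, ← pow_succ']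
    simp only [Equiv.Perm.mul_apply, this, rot_pow]
  simp only [h1]
  rw [Finset.sum_range]
  simp only [Fin.ofNat_val_eq_self]
  refine (Equiv.sum_comp (Equiv.addLeft (Fin.last m))
    (fun x => F (cycDes u - (if u (finRotate (m+1) x) < u x then 1 else 0)))).trans ?_
  generalize hc : cycDes u = c
  have h2 : ∀ x, F (c - (if u (finRotate (m+1) x) < u x then 1 else 0)) =
      F c + (((if u (finRotate (m+1) x) < u x then 1 else 0 : ℕ)) : ℝ) * (F (c-1) - F c) := by
    intro x; split_ifs <;> simp
  simp only [h2]
  rw [Finset.sum_add_distrib, ← Finset.sum_mul, ← Nat.cast_sum]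
  have : (∑ i : Fin (m+1), if u (finRotate (m+1) i) < u i then 1 else 0) = c := hc
  rw [this]
  simp
  ring

theorem conv_cut_left {n : ℕ} (S : Equiv.Perm (Fin n) → ℝ) (g : Equiv.Perm (Fin n)) :
    convMeasure (cutMeasure n) S g =
      (∑ i ∈ Finset.range n, S ((finRotate n ^ i)⁻¹ * g)) / n := by
  unfold convMeasure cutMeasure
  simp only [Finset.card_filter, Nat.cast_sum, div_mul_eq_mul_div, Finset.sum_mul]
  rw [← Finset.sum_div, Finset.sum_comm]
  congr 1
  refine Finset.sum_congr rfl fun i _ => ?_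
  rw [Finset.sum_eq_single ((finRotate n ^ i)⁻¹ * g)]
  · simp
  · intro b _ hb
    rw [if_neg]; · simp
    intro h; apply hb; rw [h]; group
  · simp

theorem conv_cut_right {n : ℕ} (S : Equiv.Perm (Fin n) → ℝ) (g : Equiv.Perm (Fin n)) :
    convMeasure S (cutMeasure n) g =
      (∑ i ∈ Finset.range n, S (g * (finRotate n ^ i)⁻¹)) / n := by
  unfold convMeasure cutMeasure
  simp only [Finset.card_filter, Nat.cast_sum, mul_div_assoc', Finset.mul_sum]
  rw [← Finset.sum_div, Finset.sum_comm]
  congr 1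
  refine Finset.sum_congr rfl fun i _ => ?_
  rw [Finset.sum_eq_single (finRotate n ^ i)]
  · simp
  · intro b _ hb
    rw [if_neg (Ne.symm hb)]; simp
  · simp

theorem conv_inv {m k : ℕ} (g : Equiv.Perm (Fin (m+1))) (j : ℕ) :
    convMeasure (cutMeasure (m+1)) (riffleMeasure (m+1) k) (g * (finRotate (m+1) ^ j)⁻¹) =
    convMeasure (cutMeasure (m+1)) (riffleMeasure (m+1) k) g := by
  have key : ∀ g : Equiv.Perm (Fin (m+1)),
    ∑ i ∈ Finset.range (m+1), riffleMeasure (m+1) k ((finRotate (m+1) ^ i)⁻¹ * g) =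
      (cycDes g⁻¹) * (fun d => (1 / (k : ℝ) ^ (m+1)) * (Nat.choose (m + 1 + k - d - 1) (m+1) : ℝ))
        (cycDes g⁻¹ - 1) + (m + 1 - cycDes g⁻¹) *
      (fun d => (1 / (k : ℝ) ^ (m+1)) * (Nat.choose (m + 1 + k - d - 1) (m+1) : ℝ))
        (cycDes g⁻¹) := by
    intro g
    refine Eq.trans ?_ (sum_rot
      (fun d => (1 / (k : ℝ) ^ (m+1)) * (Nat.choose (m + 1 + k - d - 1) (m+1) : ℝ)) g⁻¹)
    simp only [riffleMeasure, mul_inv_rev, inv_inv]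
  have hj : cycDes (g * (finRotate (m+1) ^ j)⁻¹)⁻¹ = cycDes g⁻¹ := by
    rw [mul_inv_rev, inv_inv]
    induction j with
    | zero => simp
    | succ j ih => rw [pow_succ', mul_assoc, cycDes_rot_left, ih]
  rw [conv_cut_left, conv_cut_left, key, key, hj]

/-- A `k`-riffle shuffle followed by a cut is at least as close to uniform as a cut
followed by a `k`-riffle shuffle: `‖C∗S⁽ᵏ⁾ - U‖ ≤ ‖S⁽ᵏ⁾∗C - U‖`. -/
theorem cut_after_shuffle_more_random (n k : ℕ) (hn : 1 ≤ n) (hk : 1 ≤ k) :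
    tvDist (convMeasure (cutMeasure n) (riffleMeasure n k))
        (fun _ => 1 / (Fintype.card (Equiv.Perm (Fin n)) : ℝ))
      ≤ tvDist (convMeasure (riffleMeasure n k) (cutMeasure n))
          (fun _ => 1 / (Fintype.card (Equiv.Perm (Fin n)) : ℝ)) := by
  obtain ⟨m, rfl⟩ : ∃ m, n = m + 1 := ⟨n - 1, by omega⟩
  unfold tvDist
  refine mul_le_mul_of_nonneg_left ?_ (by norm_num)
  generalize 1 / (Fintype.card (Equiv.Perm (Fin (m+1))) : ℝ) = c
  have hpos : (0 : ℝ) < ((m + 1 : ℕ) : ℝ) := by positivity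
  set S := riffleMeasure (m+1) k with hS
  set B := convMeasure S (cutMeasure (m+1)) with hB
  have hA : ∀ g, convMeasure (cutMeasure (m+1)) S g =
      (∑ i ∈ Finset.range (m+1), B ((finRotate (m+1) ^ i)⁻¹ * g)) / ((m+1 : ℕ) : ℝ) := by
    intro g
    have h1 : convMeasure (cutMeasure (m+1)) S g =
      (∑ j ∈ Finset.range (m+1),
        convMeasure (cutMeasure (m+1)) S (g * (finRotate (m+1) ^ j)⁻¹)) / ((m+1 : ℕ) : ℝ) := by
      simp only [hS, conv_inv]
      rw [Finset.sum_const, Finset.card_range, nsmul_eq_mul]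
      field_simp
    rw [h1]
    congr 1
    simp only [hB, conv_cut_right, conv_cut_left]
    rw [← Finset.sum_div, ← Finset.sum_div, Finset.sum_comm]
    simp only [mul_assoc]
  have hle : ∀ g, |convMeasure (cutMeasure (m+1)) S g - c| ≤
      (∑ i ∈ Finset.range (m+1), |B ((finRotate (m+1) ^ i)⁻¹ * g) - c|) / ((m+1 : ℕ) : ℝ) := by
    intro g
    have h2 : convMeasure (cutMeasure (m+1)) S g - c =
      (∑ i ∈ Finset.range (m+1), (B ((finRotate (m+1) ^ i)⁻¹ * g) - c)) / ((m+1 : ℕ) : ℝ) := by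
      rw [hA, Finset.sum_sub_distrib, Finset.sum_const, Finset.card_range, nsmul_eq_mul]
      field_simp
    rw [h2, abs_div, abs_of_pos hpos]
    gcongr
    exact Finset.abs_sum_le_sum_abs _ _
  refine (Finset.sum_le_sum fun g _ => hle g).trans (le_of_eq ?_)
  rw [← Finset.sum_div, Finset.sum_comm]
  have h3 : ∀ i, ∑ g, |B ((finRotate (m+1) ^ i)⁻¹ * g) - c| = ∑ g, |B g - c| := fun i =>
    Equiv.sum_comp (Equiv.mulLeft (finRotate (m+1) ^ i)⁻¹) (fun g => |B g - c|)
  simp only [h3]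
  rw [Finset.sum_const, Finset.card_range, nsmul_eq_mul]
  field_simp
end

section
/- Let n ≥ 2, let ζ = (1 2 ⋯ n) be the n-cycle in S_n, and let w ∈ S_n. Then among the n permutations w·ζ^k for k = 0, 1, …, n−1, exactly cd(w) of them have cd(w) − 1 descents and exactly n − cd(w) of them have cd(w) descents. -/
theorem aux_pow (m k : ℕ) (i : Fin (m+1)) :
    (finRotate (m+1) ^ k) i = i + Fin.ofNat (m+1) k := by
  induction k with
  | zero => simp
  | succ k ih =>
    rw [pow_succ', Equiv.Perm.mul_apply, ih, finRotate_succ_apply]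
    have h : Fin.ofNat (m+1) (k+1) = Fin.ofNat (m+1) k + 1 := by
      apply Fin.ext
      simp [Fin.val_add]
    rw [h, add_assoc]

theorem aux_cd {n : ℕ} (w : Equiv.Perm (Fin n)) (k : ℕ) :
    numCyclicDescents (w * finRotate n ^ k) = numCyclicDescents w := by
  unfold numCyclicDescents
  refine Finset.card_equiv (finRotate n ^ k) ?_
  intro i
  have h : (finRotate n ^ k) (finRotate n i) = finRotate n ((finRotate n ^ k) i) := by
    rw [← Equiv.Perm.mul_apply, ← Equiv.Perm.mul_apply, ← pow_succ, ← pow_succ']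
  rw [Finset.mem_filter, Finset.mem_filter, Equiv.Perm.mul_apply, Equiv.Perm.mul_apply, h]
  simp only [Finset.mem_univ, true_and]

theorem aux_split (m : ℕ) (w : Equiv.Perm (Fin (m+1))) :
    numDescents w + (if w (finRotate (m+1) (Fin.last m)) < w (Fin.last m) then 1 else 0)
      = numCyclicDescents w := by
  unfold numDescents numCyclicDescents
  rw [Finset.card_filter, Finset.card_filter, Fin.sum_univ_castSucc, Fin.sum_univ_castSucc]
  simp

theorem aux_pos (m : ℕ) (hm : 1 ≤ m) (w : Equiv.Perm (Fin (m+1))) :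
    1 ≤ numCyclicDescents w := by
  unfold numCyclicDescents
  rw [Nat.one_le_iff_ne_zero, ← Nat.pos_iff_ne_zero, Finset.card_pos]
  refine ⟨w.symm (Fin.last m), ?_⟩
  simp only [Finset.mem_filter, Finset.mem_univ, true_and, Equiv.apply_symm_apply]
  refine lt_of_le_of_ne (Fin.le_last _) ?_
  intro h
  have h2 := (Equiv.eq_symm_apply w).2 h
  rw [finRotate_succ_apply] at h2
  obtain ⟨m, rfl⟩ : ∃ k, m = k + 1 := ⟨m - 1, by omega⟩
  simp at h2

theorem aux_count_s7 (m : ℕ) (w : Equiv.Perm (Fin (m+1))) :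
    ((Finset.range (m+1)).filter (fun k =>
      (w * finRotate (m+1) ^ k) (finRotate (m+1) (Fin.last m))
        < (w * finRotate (m+1) ^ k) (Fin.last m))).card = numCyclicDescents w := by
  unfold numCyclicDescents
  have h : ∀ k, (finRotate (m+1) ^ k) (finRotate (m+1) (Fin.last m))
      = finRotate (m+1) ((finRotate (m+1) ^ k) (Fin.last m)) := by
    intro k
    rw [← Equiv.Perm.mul_apply, ← Equiv.Perm.mul_apply, ← pow_succ, ← pow_succ']
  simp only [Equiv.Perm.mul_apply, h]
  refine Finset.card_bij (fun k _ => (finRotate (m+1) ^ k) (Fin.last m)) ?_ ?_ ?_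
  · intro k hk
    simpa using (Finset.mem_filter.1 hk).2
  · intro a ha b hb hab
    have ha := Finset.mem_range.1 (Finset.mem_filter.1 ha).1
    have hb := Finset.mem_range.1 (Finset.mem_filter.1 hb).1
    rw [aux_pow, aux_pow] at hab
    have hab := congrArg Fin.val (add_left_cancel hab)
    rwa [Fin.val_ofNat, Fin.val_ofNat, Nat.mod_eq_of_lt ha, Nat.mod_eq_of_lt hb] at hab
  · intro i hi
    have hi := (Finset.mem_filter.1 hi).2
    have e : (finRotate (m+1) ^ ((i - Fin.last m : Fin (m+1)) : ℕ)) (Fin.last m) = i := by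
      rw [aux_pow, Fin.ofNat_val_eq_self]
      abel
    refine ⟨((i - Fin.last m : Fin (m+1)) : ℕ), ?_, e⟩
    rw [Finset.mem_filter, e]
    exact ⟨Finset.mem_range.2 (Fin.isLt _), hi⟩

/-- Among the `n` permutations `w·ζ^k`, `k = 0, 1, …, n-1` (where `ζ = (1 2 ⋯ n)`),
exactly `cd(w)` have `cd(w) - 1` descents and exactly `n - cd(w)` have `cd(w)` descents. -/
theorem descents_of_rotations (n : ℕ) (hn : 2 ≤ n) (w : Equiv.Perm (Fin n)) :
    ((Finset.range n).filter
        (fun k => numDescents (w * finRotate n ^ k) = numCyclicDescents w - 1)).card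
        = numCyclicDescents w
      ∧ ((Finset.range n).filter
          (fun k => numDescents (w * finRotate n ^ k) = numCyclicDescents w)).card
          = n - numCyclicDescents w := by
  obtain ⟨m, rfl⟩ : ∃ k, n = k + 1 := ⟨n - 1, by omega⟩
  have hp := aux_pos m (by omega) w
  have hc := aux_count_s7 m w
  have hs : ∀ k, numDescents (w * finRotate (m+1) ^ k) +
      (if (w * finRotate (m+1) ^ k) (finRotate (m+1) (Fin.last m))
        < (w * finRotate (m+1) ^ k) (Fin.last m) then 1 else 0) = numCyclicDescents w :=
    fun k => (aux_split m _).trans (aux_cd w k)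
  have hn' := Finset.card_filter_add_card_filter_not (s := Finset.range (m+1)) (fun k =>
      (w * finRotate (m+1) ^ k) (finRotate (m+1) (Fin.last m))
        < (w * finRotate (m+1) ^ k) (Fin.last m))
  rw [hc, Finset.card_range] at hn'
  constructor
  · refine Eq.trans (congrArg _ (Finset.filter_congr ?_)) hc
    intro k _
    have := hs k
    split_ifs at this with h
    · simp only [h, iff_true]; omega
    · simp only [h, iff_false]; omega
  · refine Eq.trans (congrArg _ (Finset.filter_congr ?_)) (Nat.eq_sub_of_add_eq' hn')
    intro k _
    have := hs k
    split_ifs at this with h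
    · simp only [h, not_true, iff_false]; omega
    · simp only [h, not_false_eq_true, iff_true]; omega
end

section
/- Let q be a prime power, F_q a finite field with q elements, and n ≥ 1 an integer. For every multiset λ of positive integers with sum n, the probability that a permutation distributed as a q-riffle shuffle followed by a cut has extended cycle type λ equals the probability that a uniformly chosen monic degree-n polynomial over F_q with nonzero constant term has irreducible factor degrees λ; that is, (1/(n q^{n−1})) Σ_{w ∈ S_n, extended cycle type of w = λ} C(n + q − cd(w⁻¹) − 1, n − 1) equals #{f ∈ F_q[x] : f monic, deg f = n, f(0) ≠ 0, and the multiset of degrees of the monic irreducible factors of f counted with multiplicity equals λ} divided by (q^n − q^{n−1}). -/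
/-- The extended cycle type of a permutation of `Fin n`: the multiset of the lengths of
all of its cycles, with fixed points counted as cycles of length `1`. -/
def extCycleType {n : ℕ} (w : Equiv.Perm (Fin n)) : Multiset ℕ :=
  w.cycleType + Multiset.replicate (n - w.cycleType.sum) 1

/-- The multiset of degrees, counted with multiplicity, of the monic irreducible factors
of a polynomial over a field.  (`UniqueFactorizationMonoid.factors f` is a multiset of
irreducible factors of `f`, each associate to a unique monic irreducible factor; the
multiset of degrees does not depend on the choice of associates.) -/
noncomputable def factorDegrees {F : Type*} [Field F] (f : Polynomial F) : Multiset ℕ :=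
  (UniqueFactorizationMonoid.factors f).map Polynomial.natDegree
namespace CutShuffle

lemma key_shift {n : ℕ} [NeZero n] (x y a : Fin n) :
    (if y + a < x + a then (1:ℤ) else 0) = (if y < x then 1 else 0)
      + (if n ≤ (y:ℕ) + a then 1 else 0) - (if n ≤ (x:ℕ) + a then 1 else 0) := by
  have hx : ((x + a : Fin n) : ℕ) = if n ≤ (x:ℕ) + a then (x:ℕ) + a - n else x + a := by
    rw [Fin.val_add_eq_ite]
  have hy : ((y + a : Fin n) : ℕ) = if n ≤ (y:ℕ) + a then (y:ℕ) + a - n else y + a := by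
    rw [Fin.val_add_eq_ite]
  have h1 := x.2
  have h2 := y.2
  have h3 := a.2
  simp only [Fin.lt_def, hx, hy]
  split_ifs <;> omega

lemma finRotate_eq {n : ℕ} [NeZero n] (i : Fin n) : finRotate n i = i + 1 := by
  obtain ⟨m, rfl⟩ := Nat.exists_eq_succ_of_ne_zero (NeZero.ne n)
  simp

lemma cd_cast {n : ℕ} [NeZero n] (w : Equiv.Perm (Fin n)) :
    (numCyclicDescents w : ℤ) = ∑ j : Fin n, if w (j + 1) < w j then (1:ℤ) else 0 := by
  simp [numCyclicDescents]

lemma val_succ {n : ℕ} [NeZero n] (j : Fin n) :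
    ((j + 1 : Fin n) : ℕ) = if (j:ℕ) + 1 = n then 0 else (j:ℕ) + 1 := by
  have hj := j.2
  rw [Fin.val_add, Fin.val_one', Nat.add_mod_mod]
  split_ifs with h
  · rw [h, Nat.mod_self]
  · exact Nat.mod_eq_of_lt (by omega)

lemma val_neg_one {n : ℕ} [NeZero n] : ((-1 : Fin n) : ℕ) = n - 1 := by
  have h := val_succ (-1 : Fin n)
  rw [neg_add_cancel, Fin.val_zero] at h
  split_ifs at h with h1
  omega

/-- conjugation by a rotation -/
def rot {n : ℕ} [NeZero n] (a : Fin n) (w : Equiv.Perm (Fin n)) : Equiv.Perm (Fin n) :=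
  Equiv.addRight a * w * (Equiv.addRight a)⁻¹

lemma rot_apply {n : ℕ} [NeZero n] (a : Fin n) (w : Equiv.Perm (Fin n)) (j : Fin n) :
    rot a w (j + a) = w j + a := by
  simp [rot, Equiv.Perm.mul_apply]

lemma cd_rot {n : ℕ} [NeZero n] (a : Fin n) (w : Equiv.Perm (Fin n)) :
    numCyclicDescents (rot a w) = numCyclicDescents w := by
  zify
  rw [cd_cast, cd_cast, ← Equiv.sum_comp (Equiv.addRight a)]
  have : ∀ j : Fin n, (if rot a w (Equiv.addRight a j + 1) < rot a w (Equiv.addRight a j) then (1:ℤ) else 0)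
      = (if w (j+1) < w j then 1 else 0) + (if n ≤ (w (j+1):ℕ) + a then 1 else 0)
        - (if n ≤ (w j:ℕ) + a then 1 else 0) := by
    intro j
    rw [← key_shift]
    have e1 : rot a w (Equiv.addRight a j + 1) = w (j+1) + a := by
      rw [Equiv.coe_addRight, ← rot_apply]; congr 1; exact add_right_comm j a 1
    have e2 : rot a w (Equiv.addRight a j) = w j + a := by
      rw [Equiv.coe_addRight, ← rot_apply]
    simp only [e1, e2]
  simp_rw [this]
  rw [Finset.sum_sub_distrib, Finset.sum_add_distrib]
  rw [← Equiv.sum_comp (Equiv.addRight (1 : Fin n)) (fun j => if n ≤ (w j:ℕ) + a then (1:ℤ) else 0)]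
  exact add_sub_cancel_right _ _

/-- indicator of a descent at the last position -/
def lastInd {n : ℕ} [NeZero n] (w : Equiv.Perm (Fin n)) : ℤ :=
  if w 0 < w (-1) then 1 else 0

lemma sum_lastInd_rot {n : ℕ} [NeZero n] (w : Equiv.Perm (Fin n)) :
    ∑ a : Fin n, lastInd (rot a w) =
      numCyclicDescents w - 1 + ((Finset.univ.filter (fun i => w i = i)).card : ℤ) := by
  rw [cd_cast, ← Equiv.sum_comp ((Equiv.neg (Fin n)).trans (Equiv.addRight (-1 : Fin n)))]
  have hval : ∀ j : Fin n, ((-j + -1 : Fin n) : ℕ) = n - 1 - j := by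
    intro j
    have h : (-j + -1 : Fin n) = ⟨n - 1 - j, by have := j.2; omega⟩ := by
      rw [eq_comm, add_comm, ← sub_eq_add_neg, eq_sub_iff_add_eq]
      apply Fin.ext
      have h1 := j.2
      rw [Fin.val_add_eq_ite, val_neg_one]
      simp only
      split_ifs <;> omega
    rw [h]
  have : ∀ j : Fin n, lastInd (rot (((Equiv.neg (Fin n)).trans (Equiv.addRight (-1 : Fin n))) j) w)
      = (if w (j+1) < w j then 1 else 0) + (if (j:ℕ) < w (j+1) then 1 else 0)
        - (if (j:ℕ) < w j then 1 else 0) := by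
    intro j
    have e : ((Equiv.neg (Fin n)).trans (Equiv.addRight (-1 : Fin n))) j = -j + -1 := rfl
    rw [e, lastInd]
    have h0 : rot (-j + -1) w 0 = w (j+1) + (-j + -1) := by
      rw [← rot_apply]; congr 1; abel
    have h1 : rot (-j + -1) w (-1) = w j + (-j + -1) := by
      rw [← rot_apply]; congr 1; abel
    rw [h0, h1, key_shift, hval]
    have h1 := j.2
    have e1 : ∀ x : Fin n, (n ≤ (x:ℕ) + (n - 1 - j)) ↔ (j:ℕ) < x := by intro x; omega
    simp only [e1]
  simp_rw [this]
  rw [Finset.sum_sub_distrib, Finset.sum_add_distrib]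
  have key : ∑ j : Fin n, (if (j:ℕ) < w (j+1) then (1:ℤ) else 0)
      = ∑ j : Fin n, ((if (j:ℕ) ≤ w j then (1:ℤ) else 0) - if j = 0 then 1 else 0) := by
    rw [← Equiv.sum_comp (Equiv.addRight (1 : Fin n)) (fun j => ((if (j:ℕ) ≤ w j then (1:ℤ) else 0) - if j = 0 then 1 else 0))]
    apply Finset.sum_congr rfl
    intro j _
    simp only [Equiv.coe_addRight]
    have hj := j.2
    have hw := (w (j+1)).2
    have hv := val_succ j
    simp only [Fin.ext_iff, hv, Fin.val_zero]
    by_cases h : (j:ℕ) + 1 = n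
    · simp [h]; rw [Fin.le_def]; omega
    · simp [h]; try congr 1
  have key2 : ∑ j : Fin n, (if (j:ℕ) ≤ w j then (1:ℤ) else 0)
      = ∑ j : Fin n, (if (j:ℕ) < w j then (1:ℤ) else 0) + ((Finset.univ.filter (fun i => w i = i)).card : ℤ) := by
    rw [Finset.card_filter]
    push_cast
    rw [← Finset.sum_add_distrib]
    apply Finset.sum_congr rfl
    intro j _
    simp only [Fin.ext_iff]
    split_ifs <;> omega
  rw [key, Finset.sum_sub_distrib, key2]
  simp
  ring

lemma nd_cast {n : ℕ} [NeZero n] (w : Equiv.Perm (Fin n)) :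
    (numDescents w : ℤ) = numCyclicDescents w - lastInd w := by
  rw [cd_cast]
  simp only [numDescents, finRotate_eq, Finset.card_filter]
  push_cast
  have : ∀ j : Fin n, (if (j:ℕ) + 1 < n ∧ w (j + 1) < w j then (1:ℤ) else 0)
     = (if w (j+1) < w j then 1 else 0) - if j = -1 then lastInd w else 0 := by
    intro j
    by_cases h : j = -1
    · subst h
      have : (((-1 : Fin n)) : ℕ) + 1 = n := by
        have := NeZero.one_le (n := n)
        rw [val_neg_one]; omega
      simp [this, lastInd]
    · have : (j:ℕ) + 1 < n := by
        have h1 := j.2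
        by_contra h2
        exact h (Fin.ext (by rw [val_neg_one]; omega))
      simp [this, h]
  simp_rw [this]
  simp

lemma ext_rot {n : ℕ} [NeZero n] (a : Fin n) (w : Equiv.Perm (Fin n)) :
    extCycleType (rot a w) = extCycleType w := by
  simp only [extCycleType, rot, Equiv.Perm.cycleType_conj]

lemma part1 {n : ℕ} [NeZero n] (q : ℕ) (hq : 1 ≤ q) (lam : Multiset ℕ)
    (hfix : ∀ w : Equiv.Perm (Fin n), extCycleType w = lam →
      (Finset.univ.filter (fun i => w i = i)).card = lam.count 1) :
    (n : ℤ) * ∑ w ∈ Finset.univ.filter (fun w : Equiv.Perm (Fin n) => extCycleType w = lam),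
      ((n + q - 1 - numDescents w).choose n : ℤ) =
    ((q:ℤ) - 1 + lam.count 1) *
      ∑ w ∈ Finset.univ.filter (fun w : Equiv.Perm (Fin n) => extCycleType w = lam),
      ((n + q - numCyclicDescents w - 1).choose (n - 1) : ℤ) := by
  have hn : 1 ≤ n := NeZero.one_le
  have hcd : ∀ w : Equiv.Perm (Fin n), numCyclicDescents w ≤ n := by
    intro w
    refine (Finset.card_le_univ _).trans ?_
    simp
  set S := Finset.univ.filter (fun w : Equiv.Perm (Fin n) => extCycleType w = lam) with hS
  set h : Equiv.Perm (Fin n) → ℤ := fun w => ((n + q - numCyclicDescents w - 1).choose (n - 1) : ℤ) with hh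
  have step1 : ∀ w : Equiv.Perm (Fin n), (n : ℤ) * ((n + q - 1 - numDescents w).choose n : ℤ) =
      ((q : ℤ) - numCyclicDescents w) * h w + n * (lastInd w * h w) := by
    intro w
    have h1 := nd_cast w
    have h2 := hcd w
    simp only [hh]
    set m := n + q - numCyclicDescents w - 1 with hm
    have h3 : (n : ℤ) * (m.choose n : ℤ) = ((q:ℤ) - numCyclicDescents w) * (m.choose (n-1) : ℤ) := by
      have := Nat.choose_succ_right_eq m (n-1)
      rw [Nat.sub_add_cancel hn] at this
      rcases lt_or_ge m (n-1) with h | h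
      · rw [Nat.choose_eq_zero_of_lt h, Nat.choose_eq_zero_of_lt (by omega)]; simp
      · zify [h] at this
        have e : (q:ℤ) - numCyclicDescents w = m - (n - 1 : ℕ) := by omega
        rw [e]; linarith
    unfold lastInd at *
    split_ifs at * with hl
    · have : n + q - 1 - numDescents w = m + 1 := by omega
      rw [this]
      have := Nat.choose_succ_succ m (n-1)
      rw [show (n-1).succ = n by omega] at this
      rw [show m + 1 = m.succ from rfl, this]
      push_cast
      rw [mul_add, h3]; ring
    · have : n + q - 1 - numDescents w = m := by omega
      rw [this, h3]; ring
  rw [Finset.mul_sum, Finset.sum_congr rfl (fun w _ => step1 w), Finset.sum_add_distrib, ← Finset.mul_sum]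
  have step2 : (n:ℤ) * ∑ w ∈ S, lastInd w * h w = ∑ a : Fin n, ∑ w ∈ S, lastInd (rot a w) * h w := by
    have : ∀ a : Fin n, ∑ w ∈ S, lastInd (rot a w) * h w = ∑ w ∈ S, lastInd w * h w := by
      intro a
      refine Finset.sum_bij (fun w _ => rot a w) ?_ ?_ ?_ ?_
      · intro w hw
        simp only [hS, Finset.mem_filter, Finset.mem_univ, true_and] at hw ⊢
        rw [ext_rot, hw]
      · intro w _ w' _ e
        simpa [rot] using e
      · intro w hw
        refine ⟨(Equiv.addRight a)⁻¹ * w * Equiv.addRight a, ?_, ?_⟩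
        · simp only [hS, Finset.mem_filter, Finset.mem_univ, true_and] at hw ⊢
          rw [← ext_rot a, ← hw]
          congr 1
          simp only [rot]; group
        · simp only [rot]; group
      · intro w _
        simp only [hh, cd_rot]
    simp [this]
  rw [step2, Finset.sum_comm]
  simp_rw [← Finset.sum_mul]
  rw [← Finset.sum_add_distrib, Finset.mul_sum]
  apply Finset.sum_congr rfl
  intro w hw
  rw [sum_lastInd_rot, hfix w (by simpa [hS] using hw)]
  ring

end CutShuffle
namespace CutShuffle

/-- compatibility of a permutation and a word -/
def Compat {n q : ℕ} (u : Equiv.Perm (Fin n)) (s : Fin n → Fin q) : Prop :=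
  StrictMono (fun i => toLex (s i, u i))

lemma card_strictMono_fin (n N : ℕ) :
    Nat.card {t : Fin n → Fin N // StrictMono t} = N.choose n := by
  classical
  rw [Nat.card_eq_fintype_card, Fintype.card_subtype]
  have : (Finset.powersetCard n (Finset.univ : Finset (Fin N))).card = N.choose n := by simp
  rw [← this]
  refine Finset.card_bij (fun t _ => Finset.univ.image t) ?_ ?_ ?_
  · intro t ht
    simp only [Finset.mem_filter, Finset.mem_univ, true_and] at ht
    simp [Finset.mem_powersetCard, Finset.card_image_of_injective _ ht.injective]
  · intro t ht t' ht' e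
    simp only [Finset.mem_filter, Finset.mem_univ, true_and] at ht ht'
    have : Set.range t = Set.range t' := by
      have := congrArg (fun s : Finset (Fin N) => (s : Set (Fin N))) e
      simpa using this
    exact (StrictMono.range_inj ht ht').1 this
  · intro s hs
    have hs : s.card = n := (Finset.mem_powersetCard.1 hs).2
    exact ⟨s.orderEmbOfFin hs, by simpa using (s.orderEmbOfFin hs).strictMono, by
      simp [Finset.image_orderEmbOfFin_univ]⟩

/-- number of ascents before position `i` -/
def asc {m : ℕ} (u : Equiv.Perm (Fin (m+1))) (i : Fin (m+1)) : ℕ :=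
  (Finset.univ.filter (fun j : Fin m => (j:ℕ) < i ∧ u j.castSucc < u j.succ)).card

lemma asc_zero {m : ℕ} (u : Equiv.Perm (Fin (m+1))) : asc u 0 = 0 := by
  simp [asc]

lemma asc_succ {m : ℕ} (u : Equiv.Perm (Fin (m+1))) (i : Fin m) :
    asc u i.succ = asc u i.castSucc + if u i.castSucc < u i.succ then 1 else 0 := by
  simp only [asc, Finset.card_filter]
  have : (if u i.castSucc < u i.succ then 1 else 0) =
    ∑ j : Fin m, if j = i then (if u i.castSucc < u i.succ then 1 else 0) else 0 := by simp
  rw [this, ← Finset.sum_add_distrib]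
  apply Finset.sum_congr rfl
  intro j _
  by_cases h : j = i
  · subst h; simp
  · have h' : (j:ℕ) ≠ i := fun e => h (Fin.ext e)
    have : ((j:ℕ) < i.succ) ↔ ((j:ℕ) < i.castSucc) := by simp; omega
    simp only [this, h, if_false, add_zero]

lemma asc_last {m : ℕ} (u : Equiv.Perm (Fin (m+1))) :
    asc u (Fin.last m) + numDescents u = m := by
  have h1 : numDescents u = (Finset.univ.filter (fun j : Fin m => ¬ (u j.castSucc < u j.succ))).card := by
    simp only [numDescents, Finset.card_filter]
    rw [Fin.sum_univ_castSucc]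
    simp only [finRotate_apply, Fin.coeSucc_eq_succ]
    simp only [Fin.val_last, lt_irrefl, false_and, if_false, add_zero]
    apply Finset.sum_congr rfl
    intro j _
    have hne : u j.succ ≠ u j.castSucc := fun e => by
      have := u.injective e
      simp [Fin.ext_iff] at this
    have : (((j.castSucc : Fin (m+1)) : ℕ) + 1 < m + 1 ∧ u j.succ < u j.castSucc) ↔ ¬ (u j.castSucc < u j.succ) := by
      rw [not_lt]
      constructor
      · exact fun h => h.2.le
      · exact fun h => ⟨by simp, lt_of_le_of_ne h hne⟩
    simp only [this]
  rw [h1]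
  simp only [asc, Fin.val_last, Fin.is_lt, true_and]
  rw [Finset.card_filter_add_card_filter_not]
  simp

lemma compat_iff {m q : ℕ} (u : Equiv.Perm (Fin (m+1))) (s : Fin (m+1) → Fin q) :
    Compat u s ↔ StrictMono (fun i => (s i : ℕ) + asc u i) := by
  rw [Compat, Fin.strictMono_iff_lt_succ, Fin.strictMono_iff_lt_succ]
  apply forall_congr'
  intro i
  rw [Prod.Lex.toLex_lt_toLex, asc_succ]
  simp only [Fin.lt_def, Fin.ext_iff]
  split_ifs <;> omega

lemma card_compat {m q : ℕ} (hq : 1 ≤ q) (u : Equiv.Perm (Fin (m+1))) :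
    Nat.card {s : Fin (m+1) → Fin q // Compat u s} = (m + 1 + q - 1 - numDescents u).choose (m+1) := by
  rw [← card_strictMono_fin]
  have hl := asc_last u
  have hmono : Monotone (asc u) := by
    rw [Fin.monotone_iff_le_succ]; intro i; rw [asc_succ]; omega
  refine Nat.card_congr
    { toFun := fun s => ⟨fun i => ⟨(s.1 i : ℕ) + asc u i, ?_⟩, ?_⟩
      invFun := fun t => ⟨fun i => ⟨(t.1 i : ℕ) - asc u i, ?_⟩, ?_⟩
      left_inv := ?_
      right_inv := ?_ }
  · have := (s.1 i).2
    have := hmono (Fin.le_last i)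
    omega
  · exact fun i j h => (compat_iff u s.1).1 s.2 h
  all_goals have hle : ∀ t : {t : Fin (m+1) → Fin (m + 1 + q - 1 - numDescents u) // StrictMono t}, ∀ i, asc u i ≤ t.1 i := by
    { intro t i
      induction i using Fin.induction with
      | zero => simp [asc_zero]
      | succ i ih =>
        have := t.2 (Fin.castSucc_lt_succ (i := i))
        rw [Fin.lt_def] at this
        rw [asc_succ]
        split_ifs <;> omega }
  · have hm : Monotone (fun i => (t.1 i : ℕ) - asc u i) := by
      rw [Fin.monotone_iff_le_succ]
      intro i
      have := t.2 (Fin.castSucc_lt_succ (i := i))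
      rw [Fin.lt_def] at this
      have h1 := hle t i.castSucc
      have h2 := hle t i.succ
      rw [asc_succ] at *
      split_ifs at * <;> omega
    have h1 := hm (Fin.le_last i)
    simp only at h1
    have h2 := (t.1 (Fin.last m)).2
    omega
  · rw [compat_iff]
    intro i j h
    simp only
    rw [Nat.sub_add_cancel (hle t i), Nat.sub_add_cancel (hle t j)]
    exact t.2 h
  · intro s
    ext i
    simp
  · intro t
    ext i
    simp [Nat.sub_add_cancel (hle t i)]

end CutShuffle
namespace CutShuffle

/-- infinite words, lexicographically ordered -/
abbrev Wd (q : ℕ) := Lex (ℕ → Fin q)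

/-- the shift -/
def shift {q : ℕ} (x : Wd q) : Wd q := toLex (fun k => ofLex x (k+1))

lemma shift_iter {q : ℕ} (x : Wd q) (k l : ℕ) : ofLex (shift^[k] x) l = ofLex x (l + k) := by
  induction k generalizing x with
  | zero => rfl
  | succ k ih =>
    rw [Function.iterate_succ_apply, ih]
    rfl

/-- the infinite word read along the orbit of `i` -/
def W {n q : ℕ} (u : Equiv.Perm (Fin n)) (s : Fin n → Fin q) (i : Fin n) : Wd q :=
  toLex (fun k => s (u^[k] i))

lemma shift_W {n q : ℕ} (u : Equiv.Perm (Fin n)) (s : Fin n → Fin q) (i : Fin n) :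
    shift (W u s i) = W u s (u i) := rfl

lemma shift_iter_W {n q : ℕ} (u : Equiv.Perm (Fin n)) (s : Fin n → Fin q) (i : Fin n) (k : ℕ) :
    shift^[k] (W u s i) = W u s (u^[k] i) := by
  induction k generalizing i with
  | zero => rfl
  | succ k ih =>
    rw [Function.iterate_succ_apply, shift_W, ih, Function.iterate_succ_apply]

lemma Compat.lt {n q : ℕ} {u : Equiv.Perm (Fin n)} {s : Fin n → Fin q} (h : Compat u s)
    {i j : Fin n} (hij : i < j) : s i < s j ∨ (s i = s j ∧ u i < u j) :=
  Prod.Lex.toLex_lt_toLex.1 (h hij)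

lemma Compat.mono {n q : ℕ} {u : Equiv.Perm (Fin n)} {s : Fin n → Fin q} (h : Compat u s) :
    Monotone (W u s) := by
  intro i j hij
  rcases hij.eq_or_lt with rfl | hij
  · exact le_rfl
  by_contra hlt
  rw [not_le] at hlt
  obtain ⟨k, hk1, hk2⟩ := hlt
  change ∀ l, l < k → s (u^[l] j) = s (u^[l] i) at hk1
  change s (u^[k] j) < s (u^[k] i) at hk2
  have : ∀ l, l ≤ k → u^[l] i < u^[l] j := by
    intro l
    induction l with
    | zero => intro _; exact hij
    | succ l ih =>
      intro hl
      rw [Function.iterate_succ_apply', Function.iterate_succ_apply']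
      rcases h.lt (ih (by omega)) with h1 | h1
      · exact absurd (hk1 l (by omega)) h1.ne'
      · exact h1.2
  rcases h.lt (this k le_rfl) with h1 | h1
  · exact absurd h1 hk2.not_gt
  · exact absurd h1.1 hk2.ne'

lemma Compat.tie {n q : ℕ} {u : Equiv.Perm (Fin n)} {s : Fin n → Fin q} (h : Compat u s)
    {i j : Fin n} (hij : i < j) (e : W u s i = W u s j) : u i < u j := by
  rcases h.lt hij with h1 | h1
  · exact absurd (congrFun (congrArg ofLex e) 0) h1.ne
  · exact h1.2

lemma Compat.tie_iter {n q : ℕ} {u : Equiv.Perm (Fin n)} {s : Fin n → Fin q} (h : Compat u s)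
    {i j : Fin n} (hij : i < j) (e : W u s i = W u s j) (k : ℕ) : u^[k] i < u^[k] j := by
  induction k with
  | zero => exact hij
  | succ k ih =>
    rw [Function.iterate_succ_apply', Function.iterate_succ_apply']
    apply h.tie ih
    rw [← shift_iter_W, ← shift_iter_W, e]

lemma Compat.prim {n q : ℕ} {u : Equiv.Perm (Fin n)} {s : Fin n → Fin q} (h : Compat u s)
    (i : Fin n) (k : ℕ) (e : W u s (u^[k] i) = W u s i) : u^[k] i = i := by
  by_contra hne
  have hW : ∀ r, W u s ((u^[k])^[r] i) = W u s i := by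
    intro r
    induction r with
    | zero => rfl
    | succ r ih =>
      rw [Function.iterate_succ_apply', ← shift_iter_W, ih, shift_iter_W, e]
  have hc : ∀ r a, (u^[k])^[r] (u^[k] a) = u^[k] ((u^[k])^[r] a) := by
    intro r a
    rw [← Function.iterate_succ_apply, Function.iterate_succ_apply']
  have : Function.Injective (fun r : ℕ => (u^[k])^[r] i) := by
    rcases lt_or_gt_of_ne hne with hlt | hlt
    · apply StrictAnti.injective
      apply strictAnti_nat_of_succ_lt
      intro r
      induction r with
      | zero => exact hlt
      | succ r ih =>
        rw [Function.iterate_succ_apply' _ (r+1), Function.iterate_succ_apply' _ r] at *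
        exact h.tie_iter ih (by rw [← Function.iterate_succ_apply' (u^[k]), hW, hW]) k
    · apply StrictMono.injective
      apply strictMono_nat_of_lt_succ
      intro r
      induction r with
      | zero => exact hlt
      | succ r ih =>
        rw [Function.iterate_succ_apply' _ (r+1), Function.iterate_succ_apply' _ r] at *
        exact h.tie_iter ih (by rw [← Function.iterate_succ_apply' (u^[k]), hW, hW]) k
  exact not_injective_infinite_finite _ this

lemma Compat.minimalPeriod {n q : ℕ} {u : Equiv.Perm (Fin n)} {s : Fin n → Fin q} (h : Compat u s)
    (i : Fin n) : Function.minimalPeriod shift (W u s i) = Function.minimalPeriod u i := by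
  rw [Function.minimalPeriod_eq_minimalPeriod_iff]
  intro k
  simp only [Function.IsPeriodicPt, Function.IsFixedPt, shift_iter_W]
  exact ⟨h.prim i k, fun e => by rw [e]⟩

lemma mono_unique {n : ℕ} {α : Type*} [LinearOrder α] {f g : Fin n → α} (hf : Monotone f)
    (hg : Monotone g) (h : (Finset.univ : Finset (Fin n)).val.map f = Finset.univ.val.map g) : f = g := by
  rw [Fin.univ_val_map, Fin.univ_val_map, Multiset.coe_eq_coe] at h
  exact List.ofFn_injective (h.eq_of_pairwise' hf.sortedLE_ofFn.pairwise hg.sortedLE_ofFn.pairwise)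

lemma map_perm {n : ℕ} {α : Type*} (f : Fin n → α) (σ : Equiv.Perm (Fin n)) :
    (Finset.univ : Finset (Fin n)).val.map (f ∘ σ) = Finset.univ.val.map f := by
  rw [← Multiset.map_map, Multiset.map_univ_val_equiv]

lemma exists_mono {n : ℕ} {α : Type*} [LinearOrder α] (M : Multiset α) (hM : M.card = n) :
    ∃ f : Fin n → α, Monotone f ∧ (Finset.univ : Finset (Fin n)).val.map f = M := by
  obtain ⟨f, hf⟩ : ∃ f : Fin n → α, (Finset.univ : Finset (Fin n)).val.map f = M := by
    induction M using Quotient.inductionOn with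
    | _ l =>
      have : l.length = n := hM
      subst this
      exact ⟨l.get, by rw [Fin.univ_val_map, List.ofFn_get]; rfl⟩
  exact ⟨f ∘ Tuple.sort f, Tuple.monotone_sort f, by rw [map_perm, hf]⟩

lemma W_periodic {n q : ℕ} (u : Equiv.Perm (Fin n)) (s : Fin n → Fin q) (i : Fin n) :
    shift^[orderOf u] (W u s i) = W u s i := by
  rw [shift_iter_W, Equiv.Perm.iterate_eq_pow, pow_orderOf_eq_one]
  rfl

lemma Compat.eq_sort {n q : ℕ} {u : Equiv.Perm (Fin n)} {s : Fin n → Fin q} (h : Compat u s) :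
    u⁻¹ = Tuple.sort (shift ∘ W u s) := by
  rw [Tuple.eq_sort_iff]
  have e : (shift ∘ W u s) ∘ (u⁻¹ : Equiv.Perm (Fin n)) = W u s := by
    funext i
    simp [shift_W]
  constructor
  · rw [e]; exact h.mono
  · intro i j hij hW
    by_contra hlt
    have hlt : u⁻¹ j < u⁻¹ i := lt_of_le_of_ne (not_lt.1 hlt) (fun e => hij.ne' (u⁻¹.injective e))
    have hpos := orderOf_pos u
    have e2 : W u s (u⁻¹ j) = W u s (u⁻¹ i) := by
      rw [← W_periodic u s (u⁻¹ j), ← W_periodic u s (u⁻¹ i)]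
      obtain ⟨N, hN⟩ := Nat.exists_eq_succ_of_ne_zero hpos.ne'
      rw [hN, Function.iterate_succ_apply, Function.iterate_succ_apply]
      exact congrArg _ hW.symm
    have := h.tie hlt e2
    simp at this
    exact absurd this hij.not_gt

/-- the multiset of words -/
def MW {n q : ℕ} (u : Equiv.Perm (Fin n)) (s : Fin n → Fin q) : Multiset (Wd q) :=
  Finset.univ.val.map (W u s)

lemma MW_inv {n q : ℕ} (u : Equiv.Perm (Fin n)) (s : Fin n → Fin q) :
    (MW u s).map shift = MW u s := by
  rw [MW, Multiset.map_map]
  exact map_perm (W u s) u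

lemma MW_inj {n q : ℕ} {u u' : Equiv.Perm (Fin n)} {s s' : Fin n → Fin q} (h : Compat u s)
    (h' : Compat u' s') (e : MW u s = MW u' s') : u = u' ∧ s = s' := by
  have hW : W u s = W u' s' := mono_unique h.mono h'.mono e
  refine ⟨?_, ?_⟩
  · rw [← inv_inj, h.eq_sort, h'.eq_sort, hW]
  · funext i
    exact congrFun (congrArg ofLex (congrFun hW i)) 0

lemma MW_surj {n q : ℕ} (M : Multiset (Wd q)) (hc : M.card = n) (hM : M.map shift = M) :
    ∃ (u : Equiv.Perm (Fin n)) (s : Fin n → Fin q), Compat u s ∧ MW u s = M := by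
  obtain ⟨f, hf, hfM⟩ := exists_mono M hc
  set σ := Tuple.sort (shift ∘ f) with hσ
  have h1 := (Tuple.eq_sort_iff (f := shift ∘ f) (σ := σ)).1 hσ
  have h2 : (shift ∘ f) ∘ σ = f := by
    apply mono_unique h1.1 hf
    rw [map_perm, ← Multiset.map_map, hfM, hM]
  have h3 : ∀ i, shift (f i) = f (σ⁻¹ i) := by
    intro i
    have := congrFun h2 (σ⁻¹ i)
    simpa using this
  have hWf : W σ⁻¹ (fun i => ofLex (f i) 0) = f := by
    funext i
    have : ∀ k, shift^[k] (f i) = f ((σ⁻¹ : Equiv.Perm (Fin n))^[k] i) := by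
      intro k
      induction k with
      | zero => rfl
      | succ k ih => rw [Function.iterate_succ_apply', ih, h3, Function.iterate_succ_apply']
    apply ofLex.injective
    funext k
    change ofLex (f ((σ⁻¹ : Equiv.Perm (Fin n))^[k] i)) 0 = _
    rw [← this, shift_iter, zero_add]
  refine ⟨σ⁻¹, fun i => ofLex (f i) 0, ?_, ?_⟩
  · intro i j hij
    rw [Prod.Lex.toLex_lt_toLex]
    simp only
    have hle := hf hij.le
    rcases hle.eq_or_lt with he | hlt
    · right
      refine ⟨by rw [he], ?_⟩
      by_contra hlt
      have hlt : σ⁻¹ j < σ⁻¹ i := lt_of_le_of_ne (not_lt.1 hlt) (fun e => hij.ne' (σ⁻¹.injective e))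
      have := h1.2 _ _ hlt (by simp [he])
      simp at this
      exact absurd this hij.not_gt
    · obtain ⟨k, hk1, hk2⟩ := hlt
      change ∀ l, l < k → ofLex (f i) l = ofLex (f j) l at hk1
      change ofLex (f i) k < ofLex (f j) k at hk2
      rcases Nat.eq_zero_or_pos k with rfl | hk
      · exact Or.inl hk2
      · right
        refine ⟨hk1 0 hk, ?_⟩
        have hs : shift (f i) < shift (f j) := by
          refine ⟨k - 1, ?_, ?_⟩
          · intro l hl
            exact hk1 (l+1) (by omega)
          · change ofLex (f i) (k - 1 + 1) < ofLex (f j) (k - 1 + 1)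
            rwa [Nat.sub_add_cancel hk]
        rw [h3, h3] at hs
        exact hf.reflect_lt hs
  · rw [MW, hWf, hfM]

lemma card_minPer {n : ℕ} (u : Equiv.Perm (Fin n)) (d : ℕ) :
    (Finset.univ.filter (fun i => Function.minimalPeriod u i = d)).card
      = d * (extCycleType u).count d := by
  classical
  have hcyc : ∀ x, u x ≠ x → Function.minimalPeriod u x = (u.cycleOf x).support.card := by
    intro x hx
    have hon := Equiv.Perm.isCycleOn_support_cycleOf u x
    have hmem : x ∈ (u.cycleOf x).support := by
      rw [Equiv.Perm.mem_support_cycleOf_iff]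
      exact ⟨Equiv.Perm.SameCycle.refl _ _, Equiv.Perm.mem_support.2 hx⟩
    have key : ∀ k, Function.IsPeriodicPt u k x ↔ (u.cycleOf x).support.card ∣ k := by
      intro k
      rw [Function.IsPeriodicPt, Function.IsFixedPt, Equiv.Perm.iterate_eq_pow]
      exact hon.pow_apply_eq hmem
    apply Nat.dvd_antisymm
    · exact ((key _).2 dvd_rfl).minimalPeriod_dvd
    · exact (key _).1 (Function.isPeriodicPt_minimalPeriod _ _)
  have hge2 : ∀ x, u x ≠ x → 2 ≤ Function.minimalPeriod u x := by
    intro x hx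
    rw [hcyc x hx]
    exact Equiv.Perm.two_le_card_support_cycleOf_iff.2 hx
  have hfixp : ∀ x, Function.minimalPeriod u x = 1 ↔ u x = x := by
    intro x
    exact Function.minimalPeriod_eq_one_iff_isFixedPt
  by_cases hd1 : d = 1
  · subst hd1
    simp only [hfixp]
    have h1 : u.cycleType.count 1 = 0 := by
      rw [Multiset.count_eq_zero]
      intro h
      have := Equiv.Perm.two_le_of_mem_cycleType h
      omega
    simp only [extCycleType, Multiset.count_add, h1, Multiset.count_replicate_self, zero_add, one_mul,
      Equiv.Perm.sum_cycleType]
    have := Finset.card_filter_add_card_filter_not (s := (Finset.univ : Finset (Fin n))) (fun i => u i = i)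
    have h2 : u.support = Finset.univ.filter (fun i => ¬ u i = i) := by
      ext i; simp
    rw [h2]
    simp at this
    omega
  · have e1 : (extCycleType u).count d = (u.cycleFactorsFinset.filter (fun c => c.support.card = d)).card := by
      rw [extCycleType, Multiset.count_add, Multiset.count_replicate, if_neg (Ne.symm hd1), add_zero,
        Equiv.Perm.cycleType_def, Multiset.count_map]
      simp only [Function.comp, eq_comm]
      rfl
    rw [e1, mul_comm]
    have hne : ∀ x, Function.minimalPeriod u x = d → u x ≠ x := by
      intro x hx hfx
      exact hd1 (hx.symm.trans ((hfixp x).2 hfx))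
    rw [Finset.card_eq_sum_card_fiberwise (f := u.cycleOf)
      (t := u.cycleFactorsFinset.filter (fun c => c.support.card = d))]
    · rw [Finset.sum_const_nat]
      intro c hc
      rw [Finset.mem_filter] at hc
      rw [← hc.2]
      congr 1
      ext x
      simp only [Finset.mem_filter, Finset.mem_univ, true_and]
      constructor
      · rintro ⟨h1, rfl⟩
        rw [Equiv.Perm.mem_support_cycleOf_iff]
        exact ⟨Equiv.Perm.SameCycle.refl _ _, Equiv.Perm.mem_support.2 (hne x (h1.trans hc.2))⟩
      · intro hx
        have h1 := Equiv.Perm.cycle_is_cycleOf hx hc.1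
        have h2 : u x ≠ x := by
          have := Equiv.Perm.mem_cycleFactorsFinset_support_le hc.1 hx
          exact Equiv.Perm.mem_support.1 this
        exact ⟨by rw [hcyc x h2, ← h1], h1.symm⟩
    · intro x hx
      simp only [Finset.coe_filter, Finset.mem_univ, true_and, Set.mem_ofPred_eq] at hx ⊢
      refine ⟨?_, ?_⟩
      · rw [Equiv.Perm.cycleOf_mem_cycleFactorsFinset_iff, Equiv.Perm.mem_support]
        exact hne x hx
      · rw [← hcyc x (hne x hx), hx]

lemma MW_countP {n q : ℕ} {u : Equiv.Perm (Fin n)} {s : Fin n → Fin q} (h : Compat u s) (d : ℕ) :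
    (MW u s).countP (fun x => Function.minimalPeriod shift x = d) = d * (extCycleType u).count d := by
  rw [← card_minPer, MW, Multiset.countP_map, Finset.card_def, Finset.filter_val]
  simp only [h.minimalPeriod]

lemma ext_pos {n : ℕ} (u : Equiv.Perm (Fin n)) : (extCycleType u).count 0 = 0 := by
  rw [Multiset.count_eq_zero]
  intro h
  rw [extCycleType, Multiset.mem_add] at h
  rcases h with h | h
  · have := Equiv.Perm.two_le_of_mem_cycleType h
    omega
  · have := Multiset.eq_of_mem_replicate h
    omega

lemma card_pairs {n q : ℕ} (lam : Multiset ℕ) (hpos : ∀ x ∈ lam, 0 < x) :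
    Nat.card {p : Equiv.Perm (Fin n) × (Fin n → Fin q) // Compat p.1 p.2 ∧ extCycleType p.1 = lam} =
    Nat.card {M : Multiset (Wd q) // M.map shift = M ∧ M.card = n ∧
      ∀ d, M.countP (fun x => Function.minimalPeriod shift x = d) = d * lam.count d} := by
  refine Nat.card_congr (Equiv.ofBijective (fun p => ⟨MW p.1.1 p.1.2, MW_inv _ _, by simp [MW], ?_⟩) ⟨?_, ?_⟩)
  · intro d
    rw [MW_countP p.2.1, p.2.2]
  · rintro ⟨p, h1, h2⟩ ⟨p', h1', h2'⟩ e
    have := MW_inj h1 h1' (congrArg Subtype.val e)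
    exact Subtype.ext (Prod.ext this.1 this.2)
  · rintro ⟨M, h1, h2, h3⟩
    obtain ⟨u, s, hc, hM⟩ := MW_surj M h2 h1
    refine ⟨⟨(u, s), hc, ?_⟩, Subtype.ext hM⟩
    ext d
    rcases Nat.eq_zero_or_pos d with rfl | hd
    · rw [ext_pos, eq_comm, Multiset.count_eq_zero]
      intro h
      exact absurd (hpos _ h) (by simp)
    · have := h3 d
      rw [← hM, MW_countP hc] at this
      exact Nat.eq_of_mul_eq_mul_left hd this

end CutShuffle
namespace CutShuffle
open Function

section neck
variable {α : Type*}

/-- orbits of periodic points -/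
def Neck (T : α → α) := {C : Cycle α // ∃ x ∈ periodicPts T, C = periodicOrbit T x}

/-- length of an orbit -/
def nlen {T : α → α} (C : Neck T) : ℕ := C.1.length

/-- the orbit as a multiset -/
def norb {T : α → α} (C : Neck T) : Multiset α := C.1.toMultiset

/-- orbit of a periodic point -/
noncomputable def nmk {T : α → α} (x : α) (hx : x ∈ periodicPts T) : Neck T := ⟨periodicOrbit T x, x, hx, rfl⟩

lemma mem_norb {T : α → α} (C : Neck T) (x : α) :
    x ∈ norb C ↔ ∃ hx : x ∈ periodicPts T, nmk x hx = C := by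
  obtain ⟨C, y, hy, rfl⟩ := C
  have h0 : x ∈ norb (⟨periodicOrbit T y, y, hy, rfl⟩ : Neck T) ↔ x ∈ periodicOrbit T y := by
    simp only [norb]
    rw [periodicOrbit_def, Cycle.coe_toMultiset, Multiset.mem_coe, Cycle.mem_coe_iff]
  rw [h0]
  constructor
  · intro h
    obtain ⟨k, rfl⟩ := (mem_periodicOrbit_iff hy).1 h
    have hx : T^[k] y ∈ periodicPts T := by
      rw [← minimalPeriod_pos_iff_mem_periodicPts, minimalPeriod_apply_iterate hy]
      exact minimalPeriod_pos_of_mem_periodicPts hy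
    refine ⟨hx, Subtype.ext ?_⟩
    exact periodicOrbit_apply_iterate_eq hy k
  · rintro ⟨hx, h⟩
    have := congrArg Subtype.val h
    simp only [nmk] at this
    rw [← this]
    exact self_mem_periodicOrbit hx

lemma nlen_nmk {T : α → α} (x : α) (hx : x ∈ periodicPts T) : nlen (nmk x hx) = minimalPeriod T x :=
  periodicOrbit_length

lemma norb_nodup {T : α → α} (C : Neck T) : (norb C).Nodup := by
  obtain ⟨C, y, hy, rfl⟩ := C
  have := nodup_periodicOrbit (f := T) (x := y)
  simp only [norb]
  rw [periodicOrbit_def] at *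
  exact this

lemma nlen_pos {T : α → α} (C : Neck T) : 0 < nlen C := by
  obtain ⟨C, y, hy, rfl⟩ := C
  change 0 < (periodicOrbit T y).length
  rw [periodicOrbit_length]
  exact minimalPeriod_pos_of_mem_periodicPts hy

lemma norb_card {T : α → α} (C : Neck T) : (norb C).card = nlen C := by
  simp [norb, nlen]

lemma minPer_of_mem {T : α → α} {C : Neck T} {x : α} (h : x ∈ norb C) :
    minimalPeriod T x = nlen C := by
  obtain ⟨hx, rfl⟩ := (mem_norb C x).1 h
  rw [nlen_nmk]

lemma map_norb {T : α → α} (C : Neck T) : (norb C).map T = norb C := by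
  obtain ⟨C, y, hy, rfl⟩ := C
  conv_rhs => simp only [norb]; rw [← periodicOrbit_apply_eq hy]
  simp only [norb, periodicOrbit_def, Cycle.coe_toMultiset, Multiset.map_coe, List.map_map,
    minimalPeriod_apply hy]
  congr 1
  apply List.map_congr_left
  intro k _
  exact (iterate_succ_apply' T k y).symm.trans (iterate_succ_apply T k y)

open Classical in
lemma count_bind_norb {T : α → α} (N : Multiset (Neck T)) (x : α) (hx : x ∈ periodicPts T) :
    (N.bind norb).count x = N.count (nmk x hx) := by
  rw [Multiset.count_bind]
  induction N using Multiset.induction_on with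
  | empty => simp
  | cons C N ih =>
    rw [Multiset.map_cons, Multiset.sum_cons, ih, Multiset.count_cons, add_comm]
    congr 1
    rw [Multiset.count_eq_of_nodup (norb_nodup C)]
    have : x ∈ norb C ↔ nmk x hx = C := by
      rw [mem_norb]; exact ⟨fun ⟨_, h⟩ => h, fun h => ⟨hx, h⟩⟩
    simp only [this]

lemma countP_bind_norb {T : α → α} (N : Multiset (Neck T)) (d : ℕ) :
    (N.bind norb).countP (fun x => minimalPeriod T x = d) = d * (N.map nlen).count d := by
  induction N using Multiset.induction_on with
  | empty => simp
  | cons C N ih =>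
    rw [Multiset.cons_bind, Multiset.countP_add, ih, Multiset.map_cons, Multiset.count_cons, mul_add, add_comm]
    congr 1
    split_ifs with h
    · rw [mul_one, h, ← norb_card, Multiset.countP_eq_card]
      intro x hx
      rw [minPer_of_mem hx, norb_card]
    · rw [mul_zero, Multiset.countP_eq_zero]
      intro x hx e
      rw [minPer_of_mem hx] at e
      exact h e.symm

lemma inv_injOn {T : α → α} {M : Multiset α} (hM : M.map T = M) : Set.InjOn T {x | x ∈ M} := by
  classical
  have h1 : M.toFinset.image T = M.toFinset := by
    rw [← Multiset.toFinset_map, hM]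
  have h2 := Finset.injOn_of_card_image_eq (s := M.toFinset) (f := T) (by rw [h1])
  intro x hx y hy e
  exact h2 (by simpa using hx) (by simpa using hy) e

lemma inv_mem {T : α → α} {M : Multiset α} (hM : M.map T = M) {x : α} (hx : x ∈ M) : T x ∈ M := by
  rw [← hM]; exact Multiset.mem_map_of_mem T hx

lemma inv_periodic {T : α → α} {M : Multiset α} (hM : M.map T = M) {x : α} (hx : x ∈ M) :
    x ∈ periodicPts T := by
  classical
  let g : {x // x ∈ M.toFinset} → {x // x ∈ M.toFinset} :=
    fun y => ⟨T y.1, by have := y.2; rw [Multiset.mem_toFinset] at *; exact inv_mem hM this⟩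
  have hg : Injective g := by
    intro a b e
    have ha := a.2; have hb := b.2
    rw [Multiset.mem_toFinset] at ha hb
    exact Subtype.ext (inv_injOn hM ha hb (congrArg Subtype.val e))
  rw [injective_iff_periodicPts_eq_univ] at hg
  have : (⟨x, by simpa using hx⟩ : {x // x ∈ M.toFinset}) ∈ periodicPts g := by rw [hg]; trivial
  obtain ⟨k, hk, hk2⟩ := this
  refine ⟨k, hk, ?_⟩
  have hit : ∀ k (y : {x // x ∈ M.toFinset}), (g^[k] y).1 = T^[k] y.1 := by
    intro k
    induction k with
    | zero => intro y; rfl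
    | succ k ih => intro y; rw [iterate_succ_apply, ih, iterate_succ_apply]
  have := congrArg Subtype.val hk2
  rw [hit] at this
  exact this

open Classical in
lemma inv_count {T : α → α} {M : Multiset α} (hM : M.map T = M) {x : α} (hx : x ∈ M) (k : ℕ) :
    T^[k] x ∈ M ∧ M.count (T^[k] x) = M.count x := by
  induction k with
  | zero => exact ⟨hx, rfl⟩
  | succ k ih =>
    rw [iterate_succ_apply']
    refine ⟨inv_mem hM ih.1, ?_⟩
    rw [← ih.2]
    conv_lhs => rw [← hM]
    exact Multiset.count_map_eq_count T M (inv_injOn hM) _ ih.1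

open Classical in
lemma inv_count_orb {T : α → α} {M : Multiset α} (hM : M.map T = M) {x y : α}
    (hx : x ∈ periodicPts T) (hy : y ∈ periodicPts T) (e : nmk x hx = nmk y hy) :
    M.count x = M.count y := by
  have key : ∀ x y : α, ∀ (hx : x ∈ periodicPts T) (hy : y ∈ periodicPts T), nmk x hx = nmk y hy →
      y ∈ M → x ∈ M ∧ M.count x = M.count y := by
    intro x y hx hy e hyM
    have h1 : x ∈ periodicOrbit T y := by
      have : periodicOrbit T x = periodicOrbit T y := congrArg Subtype.val e
      rw [← this]; exact self_mem_periodicOrbit hx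
    obtain ⟨k, rfl⟩ := (mem_periodicOrbit_iff hy).1 h1
    exact inv_count hM hyM k
  by_cases h : y ∈ M
  · exact (key x y hx hy e h).2
  · have h2 : x ∉ M := fun h2 => h (key y x hy hx e.symm h2).1
    rw [Multiset.count_eq_zero_of_notMem h, Multiset.count_eq_zero_of_notMem h2]

lemma neck_surj {T : α → α} {M : Multiset α} (hM : M.map T = M) :
    ∃ N : Multiset (Neck T), N.bind norb = M := by
  classical
  have hrep : ∀ C : Neck T, ∃ x, ∃ hx : x ∈ periodicPts T, nmk x hx = C := by
    rintro ⟨C, x, hx, rfl⟩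
    exact ⟨x, hx, rfl⟩
  choose rep hper hrep using hrep
  have hfin : (support fun C : Neck T => M.count (rep C)).Finite := by
    apply Set.Finite.of_finite_image (f := rep)
    · apply Set.Finite.subset M.toFinset.finite_toSet
      rintro _ ⟨C, hC, rfl⟩
      simp only [mem_support, ne_eq, Multiset.count_eq_zero, not_not] at hC
      simpa using hC
    · intro C _ C' _ e
      rw [← hrep C, ← hrep C']
      simp only [e]
  refine ⟨Finsupp.toMultiset (Finsupp.ofSupportFinite _ hfin), ?_⟩
  ext x
  by_cases hx : x ∈ periodicPts T
  · rw [count_bind_norb _ x hx, Finsupp.count_toMultiset]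
    change M.count (rep _) = _
    exact inv_count_orb hM _ hx (hrep _)
  · rw [Multiset.count_eq_zero_of_notMem, Multiset.count_eq_zero_of_notMem]
    · exact fun h => hx (inv_periodic hM h)
    · intro h
      rw [Multiset.mem_bind] at h
      obtain ⟨C, _, hC⟩ := h
      exact hx ((mem_norb C x).1 hC).1

lemma neck_inj {T : α → α} {N N' : Multiset (Neck T)} (h : N.bind norb = N'.bind norb) : N = N' := by
  classical
  ext C
  obtain ⟨C, x, hx, rfl⟩ := C
  have := congrArg (Multiset.count x) h
  rw [count_bind_norb _ x hx, count_bind_norb _ x hx] at this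
  exact this

lemma bind_norb_inv {T : α → α} (N : Multiset (Neck T)) : (N.bind norb).map T = N.bind norb := by
  rw [Multiset.map_bind]
  simp only [map_norb]

lemma card_inv (T : α → α) (lam : Multiset ℕ) (hpos : ∀ x ∈ lam, 0 < x) :
    Nat.card {M : Multiset α // M.map T = M ∧ M.card = lam.sum ∧
      ∀ d, M.countP (fun x => minimalPeriod T x = d) = d * lam.count d} =
    Nat.card {N : Multiset (Neck T) // N.map nlen = lam} := by
  symm
  refine Nat.card_congr (Equiv.ofBijective (fun N => ⟨N.1.bind norb, bind_norb_inv _, ?_, ?_⟩) ⟨?_, ?_⟩)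
  · rw [Multiset.card_bind]
    refine (congrArg Multiset.sum ?_).trans (congrArg Multiset.sum N.2)
    exact Multiset.map_congr rfl (fun C _ => norb_card C)
  · intro d
    rw [countP_bind_norb, N.2]
  · intro N N' e
    exact Subtype.ext (neck_inj (congrArg Subtype.val e))
  · rintro ⟨M, h1, h2, h3⟩
    obtain ⟨N, rfl⟩ := neck_surj h1
    refine ⟨⟨N, ?_⟩, rfl⟩
    ext d
    rcases Nat.eq_zero_or_pos d with rfl | hd
    · rw [Multiset.count_eq_zero_of_notMem, Multiset.count_eq_zero_of_notMem]
      · intro h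
        exact absurd (hpos _ h) (by simp)
      · intro h
        obtain ⟨C, _, hC⟩ := Multiset.mem_map.1 h
        exact (nlen_pos C).ne' hC
    · have := h3 d
      rw [countP_bind_norb] at this
      exact Nat.eq_of_mul_eq_mul_left hd this

/-- sum of the orbit lengths dividing `n` = number of points of period `n` -/
lemma neck_sum (T : α → α) (n : ℕ) (hn : 1 ≤ n) (X : Finset α) (hX : ∀ x, x ∈ X ↔ T^[n] x = x) :
    ∃ K : Finset (Neck T), (∀ C, C ∈ K ↔ nlen C ∣ n) ∧ ∑ C ∈ K, nlen C = X.card := by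
  classical
  have hper : ∀ x ∈ X, x ∈ periodicPts T := fun x hx => ⟨n, hn, (hX x).1 hx⟩
  have hmin : ∀ x, x ∈ X ↔ minimalPeriod T x ∣ n := by
    intro x
    rw [hX, ← isPeriodicPt_iff_minimalPeriod_dvd]; rfl
  refine ⟨X.attach.image (fun x => nmk x.1 (hper x.1 x.2)), ?_, ?_⟩
  · rintro ⟨C, x, hx, rfl⟩
    constructor
    · intro h
      obtain ⟨y, _, hy⟩ := Finset.mem_image.1 h
      rw [← hy, nlen_nmk]
      exact (hmin _).1 y.2
    · intro h
      have h : nlen (nmk x hx) ∣ n := h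
      rw [nlen_nmk] at h
      exact Finset.mem_image.2 ⟨⟨x, (hmin x).2 h⟩, Finset.mem_attach _ _, rfl⟩
  · rw [← Finset.card_attach (s := X), Finset.card_eq_sum_card_image (fun x : {x // x ∈ X} => nmk x.1 (hper x.1 x.2)) X.attach]
    apply Finset.sum_congr rfl
    intro C hC
    obtain ⟨y, _, hy⟩ := Finset.mem_image.1 hC
    rw [← norb_card]
    have : (norb C) = (⟨norb C, norb_nodup C⟩ : Finset α).val := rfl
    rw [this, ← Finset.card_def, ← Finset.card_map (Function.Embedding.subtype _)]
    congr 1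
    ext x
    simp only [Finset.mem_mk, mem_norb, Finset.mem_map, Finset.mem_filter, Finset.mem_attach, true_and,
      Function.Embedding.subtype_apply]
    constructor
    · rintro ⟨hx, h⟩
      have hxX : x ∈ X := by
        rw [hmin, ← nlen_nmk x hx, h, ← hy, nlen_nmk]
        exact (hmin _).1 y.2
      exact ⟨⟨x, hxX⟩, h, rfl⟩
    · rintro ⟨z, h, rfl⟩
      exact ⟨_, h⟩

end neck

lemma word_fixed (q n : ℕ) (hn : 1 ≤ n) :
    ∃ X : Finset (Wd q), (∀ x, x ∈ X ↔ shift^[n] x = x) ∧ X.card = q ^ n := by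
  classical
  let f : (Fin n → Fin q) → Wd q := fun a => toLex (fun k => a ⟨k % n, Nat.mod_lt _ hn⟩)
  have hf : Injective f := by
    intro a b e
    funext i
    have := congrFun (congrArg ofLex e) i
    simpa [f, Nat.mod_eq_of_lt i.2] using this
  refine ⟨Finset.univ.image f, ?_, ?_⟩
  · intro x
    simp only [Finset.mem_image, Finset.mem_univ, true_and]
    constructor
    · rintro ⟨a, rfl⟩
      apply ofLex.injective
      funext k
      rw [shift_iter]
      simp [f]
    · intro h
      have h1 : ∀ k, ofLex x (k + n) = ofLex x k := by
        intro k; rw [← shift_iter, h]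
      refine ⟨fun i => ofLex x i, ?_⟩
      apply ofLex.injective
      funext k
      change ofLex x (k % n) = ofLex x k
      have h2 : ∀ l m, ofLex x (l + n * m) = ofLex x l := by
        intro l m
        induction m with
        | zero => rfl
        | succ m ih => rw [mul_add, mul_one, ← add_assoc, h1, ih]
      conv_rhs => rw [← Nat.mod_add_div k n]
      rw [h2]
  · rw [Finset.card_image_of_injective _ hf]
    simp

end CutShuffle
namespace CutShuffle

/-- the hypothesis on weighted sums -/
def GoodDeg {ι : Type*} (deg : ι → ℕ) (q : ℕ) : Prop :=
  (∀ i, 0 < deg i) ∧ ∀ n, 1 ≤ n → ∃ K : Finset ι, (∀ i, i ∈ K ↔ deg i ∣ n) ∧ ∑ i ∈ K, deg i = q ^ n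

lemma GoodDeg.finite {ι : Type*} {deg : ι → ℕ} {q : ℕ} (h : GoodDeg deg q) (d : ℕ) :
    Finite {i // deg i = d} := by
  rcases Nat.eq_zero_or_pos d with rfl | hd
  · have : IsEmpty {i // deg i = 0} := ⟨fun i => (h.1 i.1).ne' i.2⟩
    infer_instance
  · obtain ⟨K, hK, -⟩ := h.2 d hd
    apply Set.Finite.subset K.finite_toSet
    intro i hi
    have hi : deg i = d := hi
    exact (hK i).2 (by rw [hi])

lemma GoodDeg.sum_div {ι : Type*} {deg : ι → ℕ} {q : ℕ} (h : GoodDeg deg q) (n : ℕ) (hn : 1 ≤ n) :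
    ∑ e ∈ n.divisors, e * Nat.card {i // deg i = e} = q ^ n := by
  classical
  obtain ⟨K, hK, hs⟩ := h.2 n hn
  rw [← hs, ← Finset.sum_fiberwise_of_maps_to (s := K) (t := n.divisors) (g := deg)
    (fun i hi => Nat.mem_divisors.2 ⟨(hK i).1 hi, by omega⟩)]
  apply Finset.sum_congr rfl
  intro e he
  rw [Finset.sum_congr rfl (g := fun _ => e) (fun i hi => (Finset.mem_filter.1 hi).2),
    Finset.sum_const, smul_eq_mul, mul_comm]
  congr 1
  apply Nat.subtype_card
  intro i
  rw [Finset.mem_filter, hK]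
  exact ⟨fun h => h.2, fun h => ⟨by rw [h]; exact Nat.dvd_of_mem_divisors he, h⟩⟩

lemma GoodDeg.card_eq {ι ι' : Type*} {deg : ι → ℕ} {deg' : ι' → ℕ} {q : ℕ} (h : GoodDeg deg q)
    (h' : GoodDeg deg' q) (d : ℕ) : Nat.card {i // deg i = d} = Nat.card {i // deg' i = d} := by
  induction d using Nat.strong_induction_on with
  | _ d ih =>
    rcases Nat.eq_zero_or_pos d with rfl | hd
    · have : IsEmpty {i // deg i = 0} := ⟨fun i => (h.1 i.1).ne' i.2⟩
      have : IsEmpty {i // deg' i = 0} := ⟨fun i => (h'.1 i.1).ne' i.2⟩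
      simp
    · have h1 := h.sum_div d hd
      rw [← h'.sum_div d hd, ← Nat.insert_self_properDivisors hd.ne',
        Finset.sum_insert (by simp), Finset.sum_insert (by simp)] at h1
      have h2 : ∑ e ∈ d.properDivisors, e * Nat.card {i // deg i = e} =
          ∑ e ∈ d.properDivisors, e * Nat.card {i // deg' i = e} :=
        Finset.sum_congr rfl (fun e he => by rw [ih e (Nat.mem_properDivisors.1 he).2])
      rw [h2] at h1
      exact Nat.eq_of_mul_eq_mul_left hd (Nat.add_right_cancel h1)

/-- monic irreducible polynomials -/
def MI (F : Type*) [Field F] := {p : Polynomial F // p.Monic ∧ Irreducible p}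

/-- degree -/
noncomputable def mdeg {F : Type*} [Field F] (p : MI F) : ℕ := p.1.natDegree

open Polynomial UniqueFactorizationMonoid in
lemma good_MI (F : Type*) [Field F] [Fintype F] : GoodDeg (mdeg (F := F)) (Fintype.card F) := by
  classical
  refine ⟨fun p => p.2.2.natDegree_pos, fun n hn => ?_⟩
  set q := Fintype.card F with hq
  have h1q : 1 < q := Fintype.one_lt_card
  set P : F[X] := X ^ q ^ n - X with hP
  have hP0 : P ≠ 0 := FiniteField.X_pow_card_pow_sub_X_ne_zero F (by omega) h1q
  have hPd : P.natDegree = q ^ n := FiniteField.X_pow_card_pow_sub_X_natDegree_eq F (by omega) h1q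
  have hPm : P.Monic := monic_X_pow_sub (by
    rw [degree_X]; exact_mod_cast (Nat.one_lt_pow (by omega) h1q))
  have hsep : P.Separable := by
    obtain ⟨p, hp⟩ := CharP.exists F
    have : Fact p.Prime := ⟨CharP.char_is_prime F p⟩
    apply galois_poly_separable p
    obtain ⟨k, hk1, hk⟩ := FiniteField.card F p
    rw [hq, hk]
    exact dvd_pow (dvd_pow_self p k.ne_zero) (by omega)
  have hnd : (normalizedFactors P).Nodup := (squarefree_iff_nodup_normalizedFactors hP0).1 hsep.squarefree
  have hmem : ∀ p, p ∈ normalizedFactors P ↔ p.Monic ∧ Irreducible p ∧ p ∣ P := by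
    intro p
    constructor
    · intro h
      have hi := irreducible_of_normalized_factor p h
      refine ⟨?_, hi, dvd_of_mem_normalizedFactors h⟩
      rw [← normalize_normalized_factor p h]
      exact monic_normalize hi.ne_zero
    · rintro ⟨h1, h2, h3⟩
      rw [mem_normalizedFactors_iff' hP0]
      exact ⟨h2, h1.normalize_eq_self, h3⟩
  let K : Finset (MI F) := (⟨normalizedFactors P, hnd⟩ : Finset F[X]).subtype _
  refine ⟨K, ?_, ?_⟩
  · rintro ⟨p, h1, h2⟩
    have hK : (⟨p, h1, h2⟩ : MI F) ∈ K ↔ p ∈ normalizedFactors P := Finset.mem_subtype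
    refine hK.trans ((hmem p).trans ?_)
    have := h2.natDegree_dvd_iff_dvd_X_pow_card_pow_sub_X (n := n)
    rw [Nat.card_eq_fintype_card] at this
    refine Iff.trans ?_ this.symm
    exact ⟨fun h => h.2.2, fun h => ⟨h1, h2, h⟩⟩
  · have e1 : ∑ i ∈ K, mdeg i = ∑ p ∈ (⟨normalizedFactors P, hnd⟩ : Finset F[X]), p.natDegree := by
      apply Finset.sum_subtype_of_mem (fun p : F[X] => p.natDegree)
      intro p hp
      have := (hmem p).1 hp
      exact ⟨this.1, this.2.1⟩
    rw [e1, ← hPd]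
    have e2 : (normalizedFactors P).prod = P := by
      have := prod_normalizedFactors_eq hP0
      rw [this, hPm.normalize_eq_self]
    conv_rhs => rw [← e2]
    rw [natDegree_multiset_prod]
    · rfl
    · exact zero_notMem_normalizedFactors P

end CutShuffle
namespace CutShuffle

section mults
variable {ι ι' : Type*}

/-- number of multisets with prescribed degrees -/
noncomputable def cardM (deg : ι → ℕ) (lam : Multiset ℕ) : ℕ :=
  Nat.card {N : Multiset ι // N.map deg = lam}

lemma cardM_zero (deg : ι → ℕ) : cardM deg 0 = 1 := by
  have : Unique {N : Multiset ι // N.map deg = 0} :=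
    { default := ⟨0, rfl⟩
      uniq := fun N => Subtype.ext (Multiset.map_eq_zero.1 N.2) }
  exact Nat.card_unique

lemma cardM_replicate (deg : ι → ℕ) (d k : ℕ) [Finite {i // deg i = d}] :
    cardM deg (Multiset.replicate k d) = (Nat.card {i // deg i = d}).multichoose k := by
  classical
  have : Fintype {i // deg i = d} := Fintype.ofFinite _
  rw [Nat.card_eq_fintype_card, ← Sym.card_sym_eq_multichoose, ← Nat.card_eq_fintype_card]
  symm
  refine Nat.card_congr (Equiv.ofBijective (fun S => ⟨S.1.map Subtype.val, ?_⟩) ⟨?_, ?_⟩)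
  · rw [Multiset.map_map, Multiset.eq_replicate]
    refine ⟨by rw [Multiset.card_map]; exact S.2, ?_⟩
    intro b hb
    obtain ⟨i, _, rfl⟩ := Multiset.mem_map.1 hb
    exact i.2
  · intro S S' e
    exact Subtype.ext (Multiset.map_injective Subtype.val_injective (congrArg Subtype.val e))
  · rintro ⟨A, hA⟩
    have h2 : ∀ a ∈ A, deg a = d := by
      intro a ha
      exact (Multiset.eq_replicate.1 hA).2 _ (Multiset.mem_map_of_mem deg ha)
    lift A to Multiset {i // deg i = d} using h2
    refine ⟨⟨A, ?_⟩, rfl⟩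
    have := (Multiset.eq_replicate.1 hA).1
    simpa using this

lemma cardM_split (deg : ι → ℕ) (lam : Multiset ℕ) (d : ℕ) :
    cardM deg lam = cardM deg (lam.filter (fun x => x = d)) * cardM deg (lam.filter (fun x => ¬ x = d)) := by
  classical
  simp only [cardM]
  rw [← Nat.card_prod]
  refine Nat.card_congr
    { toFun := fun N => (⟨N.1.filter (fun i => deg i = d), ?_⟩, ⟨N.1.filter (fun i => ¬ deg i = d), ?_⟩)
      invFun := fun p => ⟨p.1.1 + p.2.1, ?_⟩
      left_inv := ?_
      right_inv := ?_ }
  · refine Eq.trans ?_ (congrArg (Multiset.filter _) N.2)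
    rw [Multiset.filter_map]; rfl
  · refine Eq.trans ?_ (congrArg (Multiset.filter _) N.2)
    rw [Multiset.filter_map]; rfl
  · rw [Multiset.map_add, p.1.2, p.2.2, Multiset.filter_add_not]
  · intro N
    exact Subtype.ext (Multiset.filter_add_not _ _)
  · rintro ⟨⟨A, hA⟩, ⟨B, hB⟩⟩
    have h1 : ∀ a ∈ A, deg a = d := by
      intro a ha
      have := Multiset.mem_map_of_mem deg ha
      rw [hA] at this
      exact (Multiset.mem_filter.1 this).2
    have h2 : ∀ a ∈ B, ¬ deg a = d := by
      intro a ha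
      have := Multiset.mem_map_of_mem deg ha
      rw [hB] at this
      exact (Multiset.mem_filter.1 this).2
    apply Prod.ext
    · apply Subtype.ext
      simp only [Multiset.filter_add]
      rw [Multiset.filter_eq_self.2 h1, Multiset.filter_eq_nil.2 h2, add_zero]
    · apply Subtype.ext
      simp only [Multiset.filter_add]
      rw [Multiset.filter_eq_self.2 h2, Multiset.filter_eq_nil.2 (fun a ha => not_not.2 (h1 a ha)), zero_add]

lemma cardM_split_choose (deg : ι → ℕ) (lam : Multiset ℕ) (d : ℕ) [Finite {i // deg i = d}] :
    cardM deg lam = (Nat.card {i // deg i = d}).multichoose (lam.count d) *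
      cardM deg (lam.filter (fun x => ¬ x = d)) := by
  rw [cardM_split deg lam d, Multiset.filter_eq', cardM_replicate]

lemma cardM_eq (deg : ι → ℕ) (deg' : ι' → ℕ) (lam : Multiset ℕ)
    (h : ∀ d ∈ lam, Finite {i // deg i = d} ∧ Finite {i // deg' i = d} ∧
      Nat.card {i // deg i = d} = Nat.card {i // deg' i = d}) : cardM deg lam = cardM deg' lam := by
  induction hn : lam.card using Nat.strong_induction_on generalizing lam with
  | _ n ih =>
    rcases Multiset.empty_or_exists_mem lam with rfl | ⟨d, hd⟩
    · rw [cardM_zero, cardM_zero]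
    · obtain ⟨h1, h2, h3⟩ := h d hd
      rw [cardM_split_choose deg lam d, cardM_split_choose deg' lam d, h3]
      congr 1
      refine ih _ ?_ _ (fun e he => h e (Multiset.mem_filter.1 he).1) rfl
      rw [← hn]
      apply Multiset.card_lt_card
      refine lt_of_le_of_ne (Multiset.filter_le _ _) ?_
      intro e
      rw [← e] at hd
      exact (Multiset.mem_filter.1 hd).2 rfl

end mults

lemma multichoose_ratio (q k : ℕ) (hq : 2 ≤ q) :
    (q - 1) * q.multichoose k = (q - 1 + k) * (q - 1).multichoose k := by
  obtain ⟨r, rfl⟩ := Nat.exists_eq_add_of_le hq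
  rw [Nat.multichoose_eq, Nat.multichoose_eq]
  have h := Nat.choose_mul_succ_eq (r + k) k
  have e1 : 2 + r + k - 1 = r + k + 1 := by omega
  have e2 : 2 + r - 1 + k - 1 = r + k := by omega
  have e3 : 2 + r - 1 = r + 1 := by omega
  have e4 : r + k + 1 - k = r + 1 := by omega
  rw [e4] at h
  rw [e2, e1, e3]
  rw [mul_comm, ← h, mul_comm]
  congr 1
  omega

open Polynomial UniqueFactorizationMonoid

lemma factorDegrees_eq {F : Type*} [Field F] [DecidableEq F] (f : F[X]) :
    factorDegrees f = (normalizedFactors f).map natDegree := by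
  rw [normalizedFactors, Multiset.map_map, factorDegrees]
  apply Multiset.map_congr rfl
  intro p _
  exact (natDegree_eq_of_degree_eq degree_normalize).symm

open Classical in
lemma card_poly {F : Type*} [Field F] {ι : Type*} (φ : ι → F[X]) (hinj : Function.Injective φ)
    (hm : ∀ i, (φ i).Monic) (hi : ∀ i, Irreducible (φ i)) (lam : Multiset ℕ) :
    Set.ncard {f : F[X] | f.Monic ∧ (∀ p ∈ normalizedFactors f, p ∈ Set.range φ) ∧ factorDegrees f = lam}
      = cardM (fun i => (φ i).natDegree) lam := by
  have hnf : ∀ N : Multiset ι, normalizedFactors (N.map φ).prod = N.map φ := by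
    intro N
    rw [normalizedFactors_prod_eq]
    · rw [Multiset.map_map]
      apply Multiset.map_congr rfl
      intro i _
      exact (hm i).normalize_eq_self
    · intro a ha
      obtain ⟨i, _, rfl⟩ := Multiset.mem_map.1 ha
      exact hi i
  rw [← Nat.card_coe_set_eq, cardM]
  symm
  refine Nat.card_congr (Equiv.ofBijective (fun N => ⟨(N.1.map φ).prod, ?_, ?_, ?_⟩) ⟨?_, ?_⟩)
  · exact monic_multiset_prod_of_monic _ _ (fun i _ => hm i)
  · intro p hp
    rw [hnf] at hp
    obtain ⟨i, _, rfl⟩ := Multiset.mem_map.1 hp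
    exact ⟨i, rfl⟩
  · rw [factorDegrees_eq, hnf, Multiset.map_map]
    exact N.2
  · intro N N' e
    have e : (N.1.map φ).prod = (N'.1.map φ).prod := congrArg Subtype.val e
    apply Subtype.ext
    apply Multiset.map_injective hinj
    rw [← hnf N.1, ← hnf N'.1, e]
  · rintro ⟨f, h1, h2, h3⟩
    have hex : ∃ N : Multiset ι, N.map φ = normalizedFactors f := by
      have : ∀ s : Multiset F[X], (∀ p ∈ s, p ∈ Set.range φ) → ∃ N : Multiset ι, N.map φ = s := by
        intro s
        induction s using Multiset.induction_on with
        | empty => intro _; exact ⟨0, rfl⟩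
        | cons a s ih =>
          intro h
          obtain ⟨N, hN⟩ := ih (fun p hp => h p (Multiset.mem_cons_of_mem hp))
          obtain ⟨i, hi⟩ := h a (Multiset.mem_cons_self a s)
          exact ⟨i ::ₘ N, by rw [Multiset.map_cons, hN, hi]⟩
      exact this _ h2
    obtain ⟨N, hN⟩ := hex
    refine ⟨⟨N, ?_⟩, ?_⟩
    · rw [← h3, factorDegrees_eq, ← hN, Multiset.map_map]; rfl
    · apply Subtype.ext
      change (N.map φ).prod = f
      rw [hN, prod_normalizedFactors_eq h1.ne_zero, h1.normalize_eq_self]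

lemma monic_of_mem {F : Type*} [Field F] [DecidableEq F] {f p : F[X]} (h : p ∈ normalizedFactors f) :
    p.Monic := by
  have hi := irreducible_of_normalized_factor p h
  rw [← normalize_normalized_factor p h]
  exact monic_normalize hi.ne_zero

lemma natDegree_eq_sum {F : Type*} [Field F] {f : F[X]} (h : f.Monic) : f.natDegree = (factorDegrees f).sum := by
  classical
  rw [factorDegrees_eq, ← natDegree_multiset_prod _ (zero_notMem_normalizedFactors f),
    prod_normalizedFactors_eq h.ne_zero, h.normalize_eq_self]

/-- monic irreducibles other than `X` -/
def MX (F : Type*) [Field F] := {p : MI F // p.1 ≠ X}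

/-- degree -/
noncomputable def mxdeg {F : Type*} [Field F] (p : MX F) : ℕ := p.1.1.natDegree

lemma card_MX {F : Type*} [Field F] (n : ℕ) (lam : Multiset ℕ) (hsum : lam.sum = n) :
    Set.ncard {f : F[X] | f.Monic ∧ f.natDegree = n ∧ f.coeff 0 ≠ 0 ∧ factorDegrees f = lam}
      = cardM (mxdeg (F := F)) lam := by
  classical
  rw [show mxdeg (F := F) = fun i : MX F => (i.1.1).natDegree from rfl,
    ← card_poly (fun i : MX F => i.1.1) (fun a b e => Subtype.ext (Subtype.ext e)) (fun i => i.1.2.1)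
      (fun i => i.1.2.2)]
  congr 1
  ext f
  simp only [Set.mem_ofPred_eq]
  constructor
  · rintro ⟨h1, h2, h3, h4⟩
    refine ⟨h1, ?_, h4⟩
    intro p hp
    refine ⟨⟨⟨p, monic_of_mem hp, irreducible_of_normalized_factor p hp⟩, ?_⟩, rfl⟩
    rintro (rfl : p = X)
    exact h3 (X_dvd_iff.1 (dvd_of_mem_normalizedFactors hp))
  · rintro ⟨h1, h2, h4⟩
    refine ⟨h1, by rw [natDegree_eq_sum h1, h4, hsum], ?_, h4⟩
    intro h3
    have hX : (X : F[X]) ∈ normalizedFactors f := by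
      rw [mem_normalizedFactors_iff' h1.ne_zero]
      exact ⟨irreducible_X, monic_X.normalize_eq_self, X_dvd_iff.2 h3⟩
    obtain ⟨i, hi⟩ := h2 _ hX
    exact i.2 hi

lemma card_fib_MI (F : Type*) [Field F] [Fintype F] : Nat.card {p : MI F // mdeg p = 1} = Fintype.card F := by
  rw [← Nat.card_eq_fintype_card]
  symm
  refine Nat.card_congr (Equiv.ofBijective
    (fun a => ⟨⟨X - C a, monic_X_sub_C a, irreducible_X_sub_C a⟩, natDegree_X_sub_C a⟩) ⟨?_, ?_⟩)
  · intro a b e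
    have e : (X - C a : F[X]) = X - C b := congrArg (fun x => x.1.1) e
    exact C_injective (sub_right_injective e)
  · rintro ⟨⟨p, h1, h2⟩, h3⟩
    have h3 : p.natDegree = 1 := h3
    refine ⟨- p.coeff 0, Subtype.ext (Subtype.ext ?_)⟩
    have := h1.eq_X_add_C h3
    change X - C (- p.coeff 0) = p
    rw [C_neg, sub_neg_eq_add, ← this]

lemma card_fib_MX (F : Type*) [Field F] [Fintype F] :
    Nat.card {p : MX F // mxdeg p = 1} = Fintype.card F - 1 := by
  classical
  have : Fintype.card F - 1 = Nat.card {a : F // a ≠ 0} := by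
    rw [Nat.card_eq_fintype_card, Fintype.card_subtype_compl, Fintype.card_subtype_eq]
  rw [this]
  symm
  refine Nat.card_congr (Equiv.ofBijective
    (fun a => ⟨⟨⟨X - C a.1, monic_X_sub_C a.1, irreducible_X_sub_C a.1⟩, ?_⟩, natDegree_X_sub_C a.1⟩) ⟨?_, ?_⟩)
  · intro e
    have e : (X - C a.1 : F[X]) = X := e
    rw [sub_eq_self, C_eq_zero] at e
    exact a.2 e
  · intro a b e
    have e : (X - C a.1 : F[X]) = X - C b.1 := congrArg (fun x => x.1.1.1) e
    exact Subtype.ext (C_injective (sub_right_injective e))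
  · rintro ⟨⟨⟨p, h1, h2⟩, h4⟩, h3⟩
    have h3 : p.natDegree = 1 := h3
    have h4 : p ≠ X := h4
    have := h1.eq_X_add_C h3
    refine ⟨⟨- p.coeff 0, ?_⟩, Subtype.ext (Subtype.ext (Subtype.ext ?_))⟩
    · intro h0
      rw [neg_eq_zero] at h0
      rw [h0, C_0, add_zero] at this
      exact h4 this
    · change X - C (- p.coeff 0) = p
      rw [C_neg, sub_neg_eq_add, ← this]

lemma card_fib_ne (F : Type*) [Field F] (d : ℕ) (hd : d ≠ 1) :
    Nat.card {p : MX F // mxdeg p = d} = Nat.card {p : MI F // mdeg p = d} := by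
  refine Nat.card_congr (Equiv.ofBijective (fun p => ⟨p.1.1, p.2⟩) ⟨?_, ?_⟩)
  · intro a b e
    exact Subtype.ext (Subtype.ext (congrArg (fun x => x.1) e))
  · rintro ⟨p, hp⟩
    refine ⟨⟨⟨p, ?_⟩, hp⟩, rfl⟩
    intro e
    apply hd
    rw [← hp, mdeg, e, natDegree_X]

lemma MX_ratio (F : Type*) [Field F] [Fintype F] (lam : Multiset ℕ) :
    (Fintype.card F - 1) * cardM (mdeg (F := F)) lam =
      (Fintype.card F - 1 + lam.count 1) * cardM (mxdeg (F := F)) lam := by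
  have hg := good_MI F
  have hf : ∀ d, Finite {p : MI F // mdeg p = d} := hg.finite
  have hf' : ∀ d, Finite {p : MX F // mxdeg p = d} := by
    intro d
    have := hf d
    refine Finite.of_injective (β := {p : MI F // mdeg p = d}) (fun p => ⟨p.1.1, p.2⟩) ?_
    intro a b e
    exact Subtype.ext (Subtype.ext (congrArg (fun x => x.1) e))
  have := hf 1
  have := hf' 1
  rw [cardM_split_choose mdeg lam 1, cardM_split_choose mxdeg lam 1, card_fib_MI, card_fib_MX,
    ← mul_assoc, ← mul_assoc, multichoose_ratio _ _ Fintype.one_lt_card]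
  congr 1
  apply cardM_eq
  intro d hd
  exact ⟨hf d, hf' d, (card_fib_ne F d (Multiset.mem_filter.1 hd).2).symm⟩

end CutShuffle
namespace CutShuffle

lemma good_neck (q : ℕ) : GoodDeg (nlen (T := shift (q := q))) q := by
  refine ⟨nlen_pos, fun n hn => ?_⟩
  obtain ⟨X, hX, hc⟩ := word_fixed q n hn
  rw [← hc]
  exact neck_sum shift n hn X hX

lemma sum_desc (q n : ℕ) (hn : 1 ≤ n) (F : Type*) [Field F] [Fintype F] (hF : Fintype.card F = q)
    (lam : Multiset ℕ) (hpos : ∀ x ∈ lam, 0 < x) (hsum : lam.sum = n) :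
    ∑ w ∈ Finset.univ.filter (fun w : Equiv.Perm (Fin n) => extCycleType w = lam),
      (n + q - 1 - numDescents w).choose n = cardM (mdeg (F := F)) lam := by
  classical
  have hq : 1 ≤ q := by rw [← hF]; exact Fintype.card_pos
  have h1 : cardM (mdeg (F := F)) lam = cardM (nlen (T := shift (q := q))) lam := by
    have hg := good_MI F
    rw [hF] at hg
    have hg' := good_neck q
    exact cardM_eq _ _ _ (fun d _ => ⟨hg.finite d, hg'.finite d, hg.card_eq hg' d⟩)
  rw [h1, cardM, ← card_inv _ lam hpos, hsum, ← card_pairs lam hpos]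
  obtain ⟨m, rfl⟩ : ∃ m, n = m + 1 := ⟨n - 1, by omega⟩
  rw [Nat.card_eq_fintype_card, Fintype.card_subtype]
  rw [Finset.card_eq_sum_card_fiberwise (f := Prod.fst)
    (t := Finset.univ.filter (fun w : Equiv.Perm (Fin (m+1)) => extCycleType w = lam))]
  · apply Finset.sum_congr rfl
    intro w hw
    have hw := (Finset.mem_filter.1 hw).2
    rw [← card_compat hq w]
    rw [Nat.card_eq_fintype_card, Fintype.card_subtype]
    apply Finset.card_bij (fun s _ => (w, s))
    · intro s hs
      simp only [Finset.mem_filter, Finset.mem_univ, true_and] at hs ⊢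
      exact ⟨⟨hs, hw⟩, trivial⟩
    · intro a _ b _ e
      exact (Prod.ext_iff.1 e).2
    · rintro ⟨u, s⟩ h
      simp only [Finset.mem_filter, Finset.mem_univ, true_and] at h
      obtain ⟨⟨h1, _⟩, rfl⟩ := h
      exact ⟨s, by simpa using h1, rfl⟩
  · intro p hp
    simp only [Finset.coe_filter, Finset.mem_univ, true_and, Set.mem_ofPred_eq] at hp ⊢
    exact hp.2

lemma ext_inv {n : ℕ} (w : Equiv.Perm (Fin n)) : extCycleType w⁻¹ = extCycleType w := by
  simp [extCycleType, Equiv.Perm.cycleType_inv]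

lemma main_nat (q n : ℕ) (hn : 1 ≤ n) (F : Type*) [Field F] [Fintype F] (hF : Fintype.card F = q)
    (lam : Multiset ℕ) (hpos : ∀ x ∈ lam, 0 < x) (hsum : lam.sum = n) :
    ((q : ℤ) - 1) * ∑ w ∈ Finset.univ.filter (fun w : Equiv.Perm (Fin n) => extCycleType w = lam),
      ((n + q - numCyclicDescents w - 1).choose (n - 1) : ℤ) = n * (cardM (mxdeg (F := F)) lam : ℤ) := by
  classical
  have hq : 2 ≤ q := by rw [← hF]; exact Fintype.one_lt_card
  have : NeZero n := ⟨by omega⟩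
  have h1 := part1 (n := n) q (by omega) lam (by
    intro w hw
    have := card_minPer w 1
    rw [one_mul, hw] at this
    rw [← this]
    congr 1
    ext i
    simp only [Finset.mem_filter, Finset.mem_univ, true_and]
    rw [Function.minimalPeriod_eq_one_iff_isFixedPt]
    rfl)
  have h2 := sum_desc q n hn F hF lam hpos hsum
  have h3 := MX_ratio F lam
  rw [hF] at h3
  have h2' : ∑ w ∈ Finset.univ.filter (fun w : Equiv.Perm (Fin n) => extCycleType w = lam),
      ((n + q - 1 - numDescents w).choose n : ℤ) = (cardM (mdeg (F := F)) lam : ℤ) := by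
    rw [← h2]; push_cast; rfl
  rw [h2'] at h1
  have h3' : ((q : ℤ) - 1) * (cardM (mdeg (F := F)) lam : ℤ) =
      ((q : ℤ) - 1 + lam.count 1) * (cardM (mxdeg (F := F)) lam : ℤ) := by
    have e : ((q - 1 : ℕ) : ℤ) = (q : ℤ) - 1 := by push_cast [show 1 ≤ q by omega]; ring
    rw [← e]; exact_mod_cast h3
  have hne : (q : ℤ) - 1 + lam.count 1 ≠ 0 := by
    have : (0 : ℤ) ≤ lam.count 1 := by positivity
    have : (2 : ℤ) ≤ q := by exact_mod_cast hq
    omega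
  apply mul_left_cancel₀ hne
  linear_combination (n : ℤ) * h3' - ((q : ℤ) - 1) * h1

end CutShuffle

/-- The chance that a permutation distributed as a `q`-riffle shuffle followed by a cut
has extended cycle type `λ` equals the probability that a uniformly chosen monic degree-`n`
polynomial over `F_q` with nonzero constant term has irreducible factor degrees `λ`. -/
theorem cut_shuffle_cycle_structure (q n : ℕ) (hq : IsPrimePow q) (hn : 1 ≤ n)
    (F : Type*) [Field F] [Fintype F] (hF : Fintype.card F = q)
    (lam : Multiset ℕ) (hpos : ∀ x ∈ lam, 0 < x) (hsum : lam.sum = n) :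
    (1 / ((n : ℝ) * (q : ℝ) ^ (n - 1))) *
        ∑ w ∈ Finset.univ.filter (fun w : Equiv.Perm (Fin n) => extCycleType w = lam),
          (Nat.choose (n + q - numCyclicDescents w⁻¹ - 1) (n - 1) : ℝ)
      = (Set.ncard {f : Polynomial F |
            f.Monic ∧ f.natDegree = n ∧ f.coeff 0 ≠ 0 ∧ factorDegrees f = lam} : ℝ)
          / ((q : ℝ) ^ n - (q : ℝ) ^ (n - 1)) := by
  have h := CutShuffle.main_nat q n hn F hF lam hpos hsum
  rw [← CutShuffle.card_MX n lam hsum] at h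
  have h2 : ∑ w ∈ Finset.univ.filter (fun w : Equiv.Perm (Fin n) => extCycleType w = lam),
      (Nat.choose (n + q - numCyclicDescents w⁻¹ - 1) (n - 1) : ℝ) =
      ∑ w ∈ Finset.univ.filter (fun w : Equiv.Perm (Fin n) => extCycleType w = lam),
      (Nat.choose (n + q - numCyclicDescents w - 1) (n - 1) : ℝ) := by
    apply Finset.sum_bij (fun w _ => w⁻¹)
    · intro w hw
      simpa [CutShuffle.ext_inv] using hw
    · intro a _ b _ e
      exact inv_injective e
    · intro b hb
      exact ⟨b⁻¹, by simpa [CutShuffle.ext_inv] using hb, inv_inv b⟩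
    · intro w _
      rfl
  rw [h2]
  have h3 : ((q : ℝ) - 1) * ∑ w ∈ Finset.univ.filter (fun w : Equiv.Perm (Fin n) => extCycleType w = lam),
      (Nat.choose (n + q - numCyclicDescents w - 1) (n - 1) : ℝ) = (n : ℝ) * (Set.ncard {f : Polynomial F |
            f.Monic ∧ f.natDegree = n ∧ f.coeff 0 ≠ 0 ∧ factorDegrees f = lam} : ℝ) := by
    exact_mod_cast h
  have hq1 : (q : ℝ) - 1 ≠ 0 := by
    have : (1 : ℝ) < q := by exact_mod_cast hq.one_lt
    linarith
  have hq0 : (q : ℝ) ≠ 0 := by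
    have : (1 : ℝ) < q := by exact_mod_cast hq.one_lt
    linarith
  have hn0 : (n : ℝ) ≠ 0 := by
    have : (1 : ℝ) ≤ n := by exact_mod_cast hn
    linarith
  have e : (q : ℝ) ^ n - (q : ℝ) ^ (n - 1) = (q : ℝ) ^ (n - 1) * ((q : ℝ) - 1) := by
    obtain ⟨m, rfl⟩ : ∃ m, n = m + 1 := ⟨n - 1, by omega⟩
    rw [Nat.add_sub_cancel, pow_succ]; ring
  have hqn : (q : ℝ) ^ (n - 1) ≠ 0 := pow_ne_zero _ hq0
  rw [e, eq_div_iff (mul_ne_zero hqn hq1), one_div, mul_inv]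
  generalize (∑ w ∈ Finset.univ.filter (fun w : Equiv.Perm (Fin n) => extCycleType w = lam),
      (Nat.choose (n + q - numCyclicDescents w - 1) (n - 1) : ℝ)) = S at *
  field_simp
  linarith
end

section
/- Let n ≥ 1 and k ≥ 1 be integers. The expected number of fixed points of a permutation of S_n distributed as a k-riffle shuffle followed by a cut equals 1; that is, Σ_{w ∈ S_n} (1/(n k^{n−1})) C(n + k − cd(w⁻¹) − 1, n − 1) · fix(w) = 1, where fix(w) is the number of fixed points of w. -/
open Finset

theorem cd_eq {n : ℕ} (w : Equiv.Perm (Fin (n+1))) :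
    numCyclicDescents w = ∑ i : Fin (n+1), if w (i+1) < w i then 1 else 0 := by
  unfold numCyclicDescents
  rw [Finset.card_filter]
  simp only [finRotate_apply]

theorem cd_le {n : ℕ} (w : Equiv.Perm (Fin (n+1))) : numCyclicDescents w ≤ n + 1 := by
  unfold numCyclicDescents
  exact (Finset.card_le_univ _).trans (by simp)

theorem cd_rot {n : ℕ} (w : Equiv.Perm (Fin (n+1))) (t : Fin (n+1)) :
    numCyclicDescents (w * Equiv.addRight t) = numCyclicDescents w := by
  rw [cd_eq, cd_eq, ← Equiv.sum_comp (Equiv.addRight t) (fun i => if w (i+1) < w i then 1 else 0)]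
  refine Finset.sum_congr rfl fun i _ => ?_
  have : i + 1 + t = i + t + 1 := add_right_comm _ _ _
  simp only [Equiv.Perm.mul_apply, Equiv.coe_addRight, this]
  congr

theorem sum_rot_s9 {n : ℕ} (t : Fin (n+1)) (f : Equiv.Perm (Fin (n+1)) → ℕ) :
    ∑ w, f (w * Equiv.addRight t) = ∑ w, f w :=
  Equiv.sum_comp (Equiv.mulRight (Equiv.addRight t)) f

/-- averaging over rotations -/
theorem avg {n : ℕ} (F : ℕ → ℕ) (g : Equiv.Perm (Fin (n+1)) → ℕ) :
    (n+1) * ∑ w, F (numCyclicDescents w) * g w =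
      ∑ w, F (numCyclicDescents w) * ∑ t : Fin (n+1), g (w * Equiv.addRight t) := by
  simp_rw [Finset.mul_sum]
  rw [Finset.sum_comm (s := Finset.univ (α := Equiv.Perm (Fin (n+1)))) (t := Finset.univ (α := Fin (n+1)))]
  have : ∀ t : Fin (n+1), ∑ w : Equiv.Perm (Fin (n+1)),
      F (numCyclicDescents w) * g (w * Equiv.addRight t)
      = ∑ w, F (numCyclicDescents w) * g w := by
    intro t
    rw [← sum_rot_s9 t (fun w => F (numCyclicDescents w) * g w)]
    simp [cd_rot]
  simp [this, Finset.mul_sum]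

theorem cd_ext {n : ℕ} (w : Equiv.Perm (Fin (n+1))) :
    numCyclicDescents (Equiv.Perm.decomposeFin.symm (0, w)) +
      (if w 0 < w (Fin.last n) then 1 else 0) = numCyclicDescents w + 1 := by
  rw [cd_eq, cd_eq, Fin.sum_univ_succ, Fin.sum_univ_castSucc, Fin.sum_univ_castSucc]
  have h1 : ∀ j : Fin n, (j.castSucc.succ + 1 : Fin (n+2)) = j.succ.succ := by
    intro j; rw [Fin.succ_castSucc, Fin.coeSucc_eq_succ]
  have h2 : ((Fin.last n).succ + 1 : Fin (n+2)) = 0 := by simp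
  simp only [h1, h2, Equiv.Perm.decomposeFin_symm_apply_succ, Fin.coeSucc_eq_succ,
    Equiv.Perm.decomposeFin_symm_apply_zero, Equiv.swap_self, Equiv.refl_apply,
    Fin.succ_lt_succ_iff, Fin.succ_pos, Fin.last_add_one, if_true, Fin.not_lt_zero, if_false]
  omega

theorem sum_ext {n : ℕ} (F : ℕ → ℕ) :
    ∑ v : Equiv.Perm (Fin (n+2)), F (numCyclicDescents v) =
      (n+2) * ∑ w : Equiv.Perm (Fin (n+1)),
        F (numCyclicDescents (Equiv.Perm.decomposeFin.symm (0, w))) := by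
  have h := avg (n := n+1) F (fun v => if v 0 = 0 then 1 else 0)
  have h3 : ∀ v : Equiv.Perm (Fin (n+2)),
      (∑ t : Fin (n+2), if (v * Equiv.addRight t) 0 = 0 then 1 else 0) = 1 := by
    intro v
    have : ∀ t : Fin (n+2), ((v * Equiv.addRight t) 0 = 0) ↔ t = v.symm 0 := by
      intro t
      simp [Equiv.eq_symm_apply]
    simp only [this]
    simp
  simp only [h3, mul_one] at h
  rw [← h]
  congr 1
  rw [← Equiv.sum_comp Equiv.Perm.decomposeFin.symm, Fintype.sum_prod_type,
    Finset.sum_eq_single 0]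
  · simp
  · intro p _ hp
    simp [hp]
  · simp

theorem step_choose (n k c : ℕ) (hk : 1 ≤ k) (hc : c ≤ n + 1) :
    c * Nat.choose (n+1+k-c) (n+1) + (n+1-c) * Nat.choose (n+1+k-(c+1)) (n+1)
      = k * Nat.choose (n+k-c) n := by
  obtain ⟨x, hx⟩ : ∃ x, n + k = x + c := ⟨n+k-c, by omega⟩
  have e1 : n+1+k-c = x+1 := by omega
  have e2 : n+1+k-(c+1) = x := by omega
  have e3 : n+k-c = x := by omega
  rw [e1, e2, e3, Nat.choose_succ_succ']
  obtain ⟨d, hd⟩ := Nat.exists_eq_add_of_le hc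
  have e4 : n+1-c = d := by omega
  rw [e4]
  have h := Nat.choose_succ_right_eq x n
  rcases Nat.lt_or_ge x n with hlt | hle
  · simp [Nat.choose_eq_zero_of_lt hlt, Nat.choose_eq_zero_of_lt (hlt.trans (Nat.lt_succ_self n))]
  · obtain ⟨y, rfl⟩ := Nat.exists_eq_add_of_le hle
    have : k = y + c := by omega
    rw [Nat.add_sub_cancel_left] at h
    have h2 : (n+y).choose (n+1) * (c+d) = (n+y).choose n * y := by rw [← h, ← hd]
    subst this
    linarith

theorem step (n k : ℕ) (hk : 1 ≤ k) :
    (n+1) * ∑ v : Equiv.Perm (Fin (n+2)), Nat.choose (n+1+k-numCyclicDescents v) (n+1)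
      = (n+2) * (k * ∑ w : Equiv.Perm (Fin (n+1)), Nat.choose (n+k-numCyclicDescents w) n) := by
  rw [sum_ext (fun c => Nat.choose (n+1+k-c) (n+1)), mul_left_comm]
  congr 1
  have h0 : ∀ w : Equiv.Perm (Fin (n+1)),
      Nat.choose (n+1+k-numCyclicDescents (Equiv.Perm.decomposeFin.symm (0, w))) (n+1)
      = Nat.choose (n+1+k-numCyclicDescents w) (n+1) * (if w 0 < w (Fin.last n) then 1 else 0)
      + Nat.choose (n+1+k-(numCyclicDescents w+1)) (n+1)
        * (if w 0 < w (Fin.last n) then 0 else 1) := by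
    intro w
    have := cd_ext w
    split_ifs at this ⊢
    · rw [Nat.add_right_cancel this]; simp
    · rw [add_zero] at this; rw [this]; simp
  simp only [h0]
  rw [Finset.sum_add_distrib, mul_add,
    avg (fun c => Nat.choose (n+1+k-c) (n+1)) (fun w => if w 0 < w (Fin.last n) then 1 else 0),
    avg (fun c => Nat.choose (n+1+k-(c+1)) (n+1)) (fun w => if w 0 < w (Fin.last n) then 0 else 1),
    ← Finset.sum_add_distrib, Finset.mul_sum]
  refine Finset.sum_congr rfl fun w _ => ?_
  have h1 : (∑ t : Fin (n+1), if (w * Equiv.addRight t) 0 < (w * Equiv.addRight t) (Fin.last n)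
      then 1 else 0) = numCyclicDescents w := by
    rw [cd_eq, ← Equiv.sum_comp (Equiv.addLeft (Fin.last n))
      (fun i => if w (i+1) < w i then 1 else 0)]
    refine Finset.sum_congr rfl fun t _ => ?_
    have : Fin.last n + t + 1 = t := by
      rw [add_right_comm, Fin.last_add_one, zero_add]
    simp [this]
  have h2 : (∑ t : Fin (n+1), if (w * Equiv.addRight t) 0 < (w * Equiv.addRight t) (Fin.last n)
      then 0 else 1) = n + 1 - numCyclicDescents w := by
    rw [← h1]
    apply Nat.eq_sub_of_add_eq
    rw [← Finset.sum_add_distrib]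
    have : ∀ (p : Prop) [Decidable p], ((if p then 0 else 1) + (if p then 1 else 0) : ℕ) = 1 := by
      intro p _; split_ifs <;> rfl
    simp only [this]
    simp
  rw [h1, h2, ← step_choose n k _ hk (cd_le w)]
  ring

theorem total (n k : ℕ) (hk : 1 ≤ k) :
    ∑ w : Equiv.Perm (Fin (n+1)), Nat.choose (n+k-numCyclicDescents w) n = (n+1) * k^n := by
  induction n with
  | zero => simp
  | succ n ih =>
    have h := step n k hk
    rw [ih] at h
    apply Nat.eq_of_mul_eq_mul_left (Nat.succ_pos n)
    rw [Nat.succ_eq_add_one, h]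
    ring

theorem total_fix (n k : ℕ) (hk : 1 ≤ k) :
    ∑ w : Equiv.Perm (Fin (n+1)), Nat.choose (n+k-numCyclicDescents w) n
      * (Finset.univ.filter (fun i => w i = i)).card = (n+1) * k^n := by
  apply Nat.eq_of_mul_eq_mul_left (Nat.succ_pos n)
  rw [Nat.succ_eq_add_one, avg (fun c => Nat.choose (n+k-c) n)
    (fun w => (Finset.univ.filter (fun i => w i = i)).card)]
  rw [← total n k hk, Finset.mul_sum]
  refine Finset.sum_congr rfl fun w _ => ?_
  rw [mul_comm]
  congr 1
  simp only [Finset.card_filter]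
  rw [Finset.sum_comm]
  have : ∀ i t : Fin (n+1), ((w * Equiv.addRight t) i = i) ↔ t = w.symm i - i := by
    intro i t
    rw [eq_sub_iff_add_eq, Equiv.eq_symm_apply, add_comm t i]
    rfl
  simp only [this]
  simp



/-- The expected number of fixed points of a permutation distributed as a `k`-riffle
shuffle followed by a cut equals `1`. -/
theorem expected_fixed_points (n k : ℕ) (hn : 1 ≤ n) (hk : 1 ≤ k) :
    ∑ w : Equiv.Perm (Fin n),
        (1 / ((n : ℚ) * (k : ℚ) ^ (n - 1)))
          * (Nat.choose (n + k - numCyclicDescents w⁻¹ - 1) (n - 1) : ℚ)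
          * ((Finset.univ.filter (fun i : Fin n => w i = i)).card : ℚ) = 1 := by
  obtain ⟨m, rfl⟩ := Nat.exists_eq_add_of_le' hn
  have h := total_fix m k hk
  rw [← Equiv.sum_comp (Equiv.inv (Equiv.Perm (Fin (m+1))))] at h
  have h' : ∀ w : Equiv.Perm (Fin (m+1)),
      (Finset.univ.filter (fun i => w⁻¹ i = i))
      = Finset.univ.filter (fun i => w i = i) := by
    intro w
    ext i
    simp only [Finset.mem_filter, Finset.mem_univ, true_and]
    rw [Equiv.Perm.inv_eq_iff_eq, eq_comm]
  simp only [Equiv.inv_apply, h'] at h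
  simp only [mul_assoc]
  rw [← Finset.mul_sum]
  have e : ∀ c, m + 1 + k - c - 1 = m + k - c := by intro c; omega
  simp only [e, Nat.add_sub_cancel]
  have hq : (∑ w : Equiv.Perm (Fin (m+1)), (Nat.choose (m+k-numCyclicDescents w⁻¹) m : ℚ)
      * ((Finset.univ.filter (fun i => w i = i)).card : ℚ)) = ((m+1 : ℕ) : ℚ) * (k:ℚ)^m := by
    exact_mod_cast h
  rw [hq]
  have : (k:ℚ) ≠ 0 := by positivity
  have : ((m+1 : ℕ):ℚ) ≠ 0 := by positivity
  field_simp
end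

section
/- Let k ≥ 2 be an integer and let u be a real number with 0 < u < 1. For each integer i ≥ 1 set m_i = (1/i) Σ_{d | i} μ(d) (k^{i/d} − 1), where μ is the Möbius function (each m_i is a nonnegative integer). Then the infinite product Π_{i=1}^∞ (1 − (u/k)^i)^{−m_i} converges and equals 1 + (k−1)u/(k(1−u)) = (k − u)/(k(1 − u)). -/
open scoped ArithmeticFunction

theorem aux_sum (k : ℕ) (m : ℕ → ℝ)
    (hm : ∀ i : ℕ, m i = (1 / (i : ℝ)) *
      ∑ d ∈ Nat.divisors i, (ArithmeticFunction.moebius d : ℝ) * ((k : ℝ) ^ (i / d) - 1))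
    (n : ℕ) (hn : 0 < n) : ∑ i ∈ n.divisors, (i : ℝ) * m i = (k : ℝ) ^ n - 1 := by
  revert n
  rw [ArithmeticFunction.sum_eq_iff_sum_mul_moebius_eq (f := fun i : ℕ => (i : ℝ) * m i)
    (g := fun n : ℕ => (k : ℝ) ^ n - 1)]
  intro n hn
  have hn' : (n : ℝ) ≠ 0 := by positivity
  rw [hm n, ← mul_assoc, mul_one_div_cancel hn', one_mul]
  exact Nat.sum_divisorsAntidiagonal
    (fun a b => ((ArithmeticFunction.moebius a : ℤ) : ℝ) * ((k : ℝ) ^ b - 1))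

theorem aux_bound (k : ℕ) (hk : 2 ≤ k) (m : ℕ → ℝ)
    (hm : ∀ i : ℕ, m i = (1 / (i : ℝ)) *
      ∑ d ∈ Nat.divisors i, (ArithmeticFunction.moebius d : ℝ) * ((k : ℝ) ^ (i / d) - 1))
    (i : ℕ) (hi : 0 < i) : |m i| ≤ (k : ℝ) ^ i := by
  have hk1 : (1 : ℝ) ≤ k := by exact_mod_cast (by omega : 1 ≤ k)
  have hi' : (0 : ℝ) < i := by positivity
  have h : |∑ d ∈ Nat.divisors i, (ArithmeticFunction.moebius d : ℝ) * ((k : ℝ) ^ (i / d) - 1)|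
      ≤ i * (k : ℝ) ^ i := by
    refine (Finset.abs_sum_le_sum_abs _ _).trans ?_
    calc _ ≤ ∑ d ∈ Nat.divisors i, (k : ℝ) ^ i := by
          refine Finset.sum_le_sum fun d _ => ?_
          have h1 : |((ArithmeticFunction.moebius d : ℤ) : ℝ)| ≤ 1 := by
            exact_mod_cast ArithmeticFunction.abs_moebius_le_one (n := d)
          have h2 : (1 : ℝ) ≤ (k : ℝ) ^ (i / d) := one_le_pow₀ hk1
          have h3 : (k : ℝ) ^ (i / d) ≤ (k : ℝ) ^ i :=
            pow_le_pow_right₀ hk1 (Nat.div_le_self _ _)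
          rw [abs_mul, abs_of_nonneg (by linarith : (0 : ℝ) ≤ (k : ℝ) ^ (i / d) - 1)]
          nlinarith [abs_nonneg ((ArithmeticFunction.moebius d : ℤ) : ℝ)]
      _ ≤ _ := by
          rw [Finset.sum_const, nsmul_eq_mul]
          gcongr
          exact Nat.card_divisors_le_self i
  rw [hm i, abs_mul, abs_of_pos (by positivity), one_div, inv_mul_le_iff₀ hi']
  exact h

theorem aux_hasSum (k : ℕ) (hk : 2 ≤ k) (u : ℝ) (hu0 : 0 < u) (hu1 : u < 1)
    (m : ℕ → ℝ)
    (hm : ∀ i : ℕ, m i = (1 / (i : ℝ)) *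
      ∑ d ∈ Nat.divisors i, (ArithmeticFunction.moebius d : ℝ) * ((k : ℝ) ^ (i / d) - 1)) :
    HasSum (fun i : ℕ => Real.log (1 - (u / (k : ℝ)) ^ (i + 1)) * (-(m (i + 1))))
      (Real.log (1 - u / k) - Real.log (1 - u)) := by
  have hk1 : (1 : ℝ) < k := by exact_mod_cast (by omega : 1 < k)
  have hk0 : (0 : ℝ) < k := by linarith
  set x : ℝ := u / k with hx
  have hx0 : 0 < x := by positivity
  have hx1 : x < 1 := by rw [hx, div_lt_one hk0]; linarith
  have hkx : (k : ℝ) * x = u := by rw [hx]; field_simp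
  let F : ℕ+ × ℕ+ → ℝ := fun p => m p.1 * (x ^ ((p.1 : ℕ) * (p.2 : ℕ)) / ((p.2 : ℕ) : ℝ))
  let e : ℕ+ × ℕ+ ≃ ℕ × ℕ := Equiv.prodCongr Equiv.pnatEquivNat Equiv.pnatEquivNat
  have hF : Summable F := by
    rw [← e.symm.summable_iff]
    have hS : Summable (fun p : ℕ × ℕ => u ^ p.1 * x ^ p.2) :=
      (summable_geometric_of_lt_one hu0.le hu1).mul_of_nonneg
        (summable_geometric_of_lt_one hx0.le hx1) (fun _ => by positivity) (fun _ => by positivity)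
    refine Summable.of_norm_bounded hS ?_
    rintro ⟨a, b⟩
    have : (F ∘ e.symm) (a, b) = m (a + 1) * (x ^ ((a + 1) * (b + 1)) / ((b + 1 : ℕ) : ℝ)) := by
      simp [F, e, Equiv.pnatEquivNat]
    rw [this, Real.norm_eq_abs, abs_mul, abs_of_pos (a := x ^ ((a + 1) * (b + 1)) / _) (by positivity)]
    have h1 := aux_bound k hk m hm (a + 1) (by omega)
    have h2 : x ^ ((a + 1) * (b + 1)) / ((b + 1 : ℕ) : ℝ) ≤ x ^ (a + 1) * x ^ b := by
      refine (div_le_self (by positivity) (by push_cast; linarith [Nat.cast_nonneg (α := ℝ) b])).trans ?_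
      rw [← pow_add]
      exact pow_le_pow_of_le_one hx0.le hx1.le (by nlinarith [Nat.zero_le (a * b)])
    calc _ ≤ (k : ℝ) ^ (a + 1) * (x ^ (a + 1) * x ^ b) := by gcongr
      _ = u ^ (a + 1) * x ^ b := by rw [← mul_assoc, ← mul_pow, hkx]
      _ ≤ u ^ a * x ^ b := by
        gcongr ?_ * _
        exact pow_le_pow_of_le_one hu0.le hu1.le (by omega)
  -- row sums
  have hlog : ∀ y : ℝ, 0 < y → y < 1 →
      HasSum (fun j : ℕ+ => y ^ (j : ℕ) / ((j : ℕ) : ℝ)) (-Real.log (1 - y)) := by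
    intro y h0 h1
    have h := Real.hasSum_pow_div_log_of_abs_lt_one (x := y) (by rw [abs_of_pos h0]; exact h1)
    rw [← Equiv.pnatEquivNat.symm.hasSum_iff]
    convert h using 2 with n
    simp [Equiv.pnatEquivNat]
  have hrow : ∀ i : ℕ+, HasSum (fun j : ℕ+ => F (i, j)) (Real.log (1 - x ^ (i : ℕ)) * (-(m i))) := by
    intro i
    have h := (hlog (x ^ (i : ℕ)) (by positivity) (pow_lt_one₀ hx0.le hx1 i.ne_zero)).mul_left (m i)
    have e1 : (fun j : ℕ+ => F (i, j))
        = fun j : ℕ+ => m i * ((x ^ (i : ℕ)) ^ (j : ℕ) / ((j : ℕ) : ℝ)) := by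
      funext j
      simp [F, pow_mul]
    have e2 : Real.log (1 - x ^ (i : ℕ)) * (-(m i)) = m i * -Real.log (1 - x ^ (i : ℕ)) := by ring
    rw [e1, e2]
    exact h
  have hA := hF.hasSum.prod_fiberwise hrow
  -- diagonal sums
  have hB := (sigmaAntidiagonalEquivProd.hasSum_iff.mpr hF.hasSum).sigma
    (g := fun n : ℕ+ => u ^ (n : ℕ) / ((n : ℕ) : ℝ) - x ^ (n : ℕ) / ((n : ℕ) : ℝ)) (by
    intro n
    have hn : ((n : ℕ) : ℝ) ≠ 0 := by positivity
    have h := hasSum_fintype (fun c : (Nat.divisorsAntidiagonal (n : ℕ)) =>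
      (F ∘ sigmaAntidiagonalEquivProd) ⟨n, c⟩)
    convert h using 1
    have h1 : ∀ c : (Nat.divisorsAntidiagonal (n : ℕ)),
        (F ∘ sigmaAntidiagonalEquivProd) ⟨n, c⟩
          = x ^ (n : ℕ) / ((n : ℕ) : ℝ) * ((c.1.1 : ℝ) * m c.1.1) := by
      rintro ⟨⟨a, b⟩, hc⟩
      have hab := (Nat.mem_divisorsAntidiagonal.mp hc).1
      simp only at hab
      have hab' : ((n : ℕ) : ℝ) = a * b := by rw [← hab]; push_cast; ring
      have ha : (a : ℝ) ≠ 0 := by rintro h; simp [h] at hab'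
      have hb : (b : ℝ) ≠ 0 := by rintro h; simp [h] at hab'
      simp only [F, Function.comp, sigmaAntidiagonalEquivProd, divisorsAntidiagonalFactors,
        Equiv.coe_fn_mk, PNat.mk_coe]
      rw [hab, hab']
      field_simp
    simp_rw [h1]
    rw [Finset.sum_coe_sort (Nat.divisorsAntidiagonal (n : ℕ))
      (fun c => x ^ (n : ℕ) / ((n : ℕ) : ℝ) * ((c.1 : ℝ) * m c.1)), ← Finset.mul_sum,
      Nat.sum_divisorsAntidiagonal (fun a _ => (a : ℝ) * m a), aux_sum k m hm n n.pos, ← hkx, mul_pow]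
    field_simp)
  have hC := (hlog u hu0 hu1).sub (hlog x hx0 hx1)
  rw [hB.unique hC] at hA
  rw [← Equiv.pnatEquivNat.symm.hasSum_iff] at hA
  convert hA using 1
  · funext i
    simp [Equiv.pnatEquivNat]
  · ring

/-- For an integer `k ≥ 2` and `0 < u < 1`, with
`m_i = (1/i) Σ_{d ∣ i} μ(d) (k^{i/d} - 1)`, the infinite product
`Π_{i=1}^∞ (1 - (u/k)^i)^(-m_i)` converges and equals `(k - u)/(k(1 - u))`. -/
theorem infinite_product_formula (k : ℕ) (hk : 2 ≤ k) (u : ℝ) (hu0 : 0 < u) (hu1 : u < 1)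
    (m : ℕ → ℝ)
    (hm : ∀ i : ℕ, m i = (1 / (i : ℝ)) *
      ∑ d ∈ Nat.divisors i, (ArithmeticFunction.moebius d : ℝ) * ((k : ℝ) ^ (i / d) - 1)) :
    Multipliable (fun i : ℕ => (1 - (u / (k : ℝ)) ^ (i + 1)) ^ (-(m (i + 1)))) ∧
      ∏' i : ℕ, (1 - (u / (k : ℝ)) ^ (i + 1)) ^ (-(m (i + 1)))
        = ((k : ℝ) - u) / ((k : ℝ) * (1 - u)) := by
  have hk1 : (1 : ℝ) < k := by exact_mod_cast (by omega : 1 < k)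
  have hk0 : (0 : ℝ) < k := by linarith
  have hx0 : 0 < u / k := by positivity
  have hx1 : u / k < 1 := by rw [div_lt_one hk0]; linarith
  have h := (aux_hasSum k hk u hu0 hu1 m hm).rexp
  have hP : HasProd (fun i : ℕ => (1 - (u / (k : ℝ)) ^ (i + 1)) ^ (-(m (i + 1))))
      (((k : ℝ) - u) / ((k : ℝ) * (1 - u))) := by
    convert h using 1
    · funext i
      have : (u / (k : ℝ)) ^ (i + 1) < 1 := pow_lt_one₀ hx0.le hx1 (by omega)
      exact Real.rpow_def_of_pos (by linarith) _
    · have h1 : 0 < 1 - u := by linarith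
      rw [Real.exp_sub, Real.exp_log (by linarith), Real.exp_log h1]
      field_simp
  exact ⟨hP.multipliable, hP.tprod_eq⟩
end

section
/- Let n ≥ 2 and let q ≥ 2 be an integer with gcd(q − 1, n) = 1. Suppose the following holds (Statement 1): for every conjugacy class C of S_n and every integer value v, letting t be the largest divisor of n with gcd(v − 1, t) = 1, the permutations w ∈ C with cd(w) = v have their major index equidistributed modulo t (i.e., for any two residues j₁, j₂ mod t, #{w ∈ C : cd(w) = v, maj(w) ≡ j₁ mod t} = #{w ∈ C : cd(w) = v, maj(w) ≡ j₂ mod t}). Then for every conjugacy class C of S_n, Σ_{w ∈ C} P_aff(w) = Σ_{w ∈ C} (1/(n q^{n−1})) C(n + q − cd(w) − 1, n − 1); that is, the affine q-shuffle measure and the measure of a q-riffle shuffle followed by a cut assign the same probability to every conjugacy class. -/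
open scoped Classical

/-- The major index of `w`: the sum of the (1-based) positions at which `w` has a descent. -/
def majIndex {n : ℕ} (w : Equiv.Perm (Fin n)) : ℕ :=
  ∑ i ∈ Finset.univ.filter (fun i : Fin n => (i : ℕ) + 1 < n ∧ w (finRotate n i) < w i),
    ((i : ℕ) + 1)

/-- The Ramanujan sum `C_r(m) = Σ_l e^{2πi l m / r}`, the sum being over all integers
`l` with `1 ≤ l ≤ r` relatively prime to `r`. -/
noncomputable def ramanujanSum (r : ℕ) (m : ℤ) : ℂ :=
  ∑ l ∈ (Finset.Icc 1 r).filter (fun l => Nat.Coprime l r),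
    Complex.exp (2 * Real.pi * Complex.I * (l : ℂ) * (m : ℂ) / (r : ℂ))

/-- The type `A` affine `q`-shuffle measure on `Sₙ`.  It assigns to `w` the probability
`(1/(n q^{n-1})) Σ_{r ∣ n, r ∣ q - cd(w⁻¹)} C((n+q-cd(w⁻¹)-r)/r, (q-cd(w⁻¹))/r) · C_r(-maj(w⁻¹))`
if `q > cd(w⁻¹)`; the probability `1/q^{n-1}` if `q = cd(w⁻¹)` and `maj(w⁻¹) ≡ 0 mod n`;
and `0` otherwise. -/
noncomputable def affineShuffle (n q : ℕ) (w : Equiv.Perm (Fin n)) : ℂ :=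
  if numCyclicDescents w⁻¹ < q then
    (1 / ((n : ℂ) * (q : ℂ) ^ (n - 1))) *
      ∑ r ∈ (Nat.divisors n).filter (fun r => r ∣ q - numCyclicDescents w⁻¹),
        (Nat.choose ((n + q - numCyclicDescents w⁻¹ - r) / r)
            ((q - numCyclicDescents w⁻¹) / r) : ℂ)
          * ramanujanSum r (-(majIndex w⁻¹ : ℤ))
  else if q = numCyclicDescents w⁻¹ ∧ majIndex w⁻¹ % n = 0 then (1 : ℂ) / (q : ℂ) ^ (n - 1)
  else 0

lemma aux_equi {α : Type*} (S : Finset α) (m : α → ℕ) (t : ℕ) (ht : 0 < t)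
    (h : ∀ j₁ j₂ : ℕ, (S.filter (fun w => m w % t = j₁ % t)).card
      = (S.filter (fun w => m w % t = j₂ % t)).card) (g : ℕ → ℂ)
    (hg : ∀ j, g (j % t) = g j) :
    ∑ w ∈ S, g (m w) = ((S.filter (fun w => m w % t = 0 % t)).card : ℂ) *
      ∑ j ∈ Finset.range t, g j := by
  rw [← Finset.sum_fiberwise_of_maps_to (s := S) (t := Finset.range t) (g := fun w => m w % t)
    (fun w _ => Finset.mem_range.2 (Nat.mod_lt _ ht)), Finset.mul_sum]
  refine Finset.sum_congr rfl fun j hj => ?_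
  have h1 : ∀ w ∈ S.filter (fun w => m w % t = j), g (m w) = g j := by
    intro w hw
    rw [← hg, (Finset.mem_filter.1 hw).2]
  rw [Finset.sum_congr rfl h1, Finset.sum_const, nsmul_eq_mul, h 0 j,
    Nat.mod_eq_of_lt (Finset.mem_range.1 hj)]

lemma aux_t (n : ℕ) (hn : 0 < n) (a : ℤ) : ∃ t : ℕ, t ∣ n ∧ Int.gcd a (t : ℤ) = 1 ∧
    (∀ t' : ℕ, t' ∣ n → Int.gcd a (t' : ℤ) = 1 → t' ≤ t) ∧
    (∀ r : ℕ, r ∣ n → Int.gcd a (r : ℤ) = 1 → r ∣ t) := by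
  obtain ⟨t, ht, hmax⟩ := Finset.exists_max_image
    (n.divisors.filter (fun t : ℕ => Int.gcd a (t : ℤ) = 1)) id ⟨1, by simp [hn.ne']⟩
  simp only [Finset.mem_filter, Nat.mem_divisors, id] at ht hmax
  refine ⟨t, ht.1.1, ht.2, fun t' h1 h2 => hmax t' ⟨⟨h1, hn.ne'⟩, h2⟩, fun r h1 h2 => ?_⟩
  have h3 : Nat.lcm r t ≤ t := by
    refine hmax _ ⟨⟨Nat.lcm_dvd h1 ht.1.1, hn.ne'⟩, ?_⟩
    have h4 : IsCoprime a ((r : ℤ) * t) :=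
      (Int.isCoprime_iff_gcd_eq_one.2 h2).mul_right (Int.isCoprime_iff_gcd_eq_one.2 ht.2)
    refine Int.isCoprime_iff_gcd_eq_one.1 (h4.of_isCoprime_of_dvd_right ?_)
    exact_mod_cast Nat.lcm_dvd_mul r t
  have h5 : Nat.lcm r t = t :=
    le_antisymm h3 (Nat.le_of_dvd (Nat.pos_of_ne_zero fun h => by
      rcases Nat.lcm_eq_zero_iff.1 h with h | h
      · subst h; exact hn.ne' (zero_dvd_iff.1 h1)
      · rw [h] at ht; exact hn.ne' (zero_dvd_iff.1 ht.1.1)) (Nat.dvd_lcm_right r t))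
  rw [← h5]; exact Nat.dvd_lcm_left r t

lemma aux_exp (r l j : ℕ) :
    Complex.exp (2 * Real.pi * Complex.I * (l : ℂ) * ((-(j : ℤ) : ℤ) : ℂ) / (r : ℂ))
      = ((Complex.exp (2 * Real.pi * Complex.I / r))⁻¹ ^ l) ^ j := by
  rw [← Complex.exp_neg, ← Complex.exp_nat_mul, ← Complex.exp_nat_mul]
  congr 1
  push_cast
  ring

lemma aux_ram_mod (r t : ℕ) (hr : 0 < r) (h : r ∣ t) (j : ℕ) :
    ramanujanSum r (-((j % t : ℕ) : ℤ)) = ramanujanSum r (-(j : ℤ)) := by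
  unfold ramanujanSum
  refine Finset.sum_congr rfl fun l _ => ?_
  rw [aux_exp, aux_exp]
  have hz := (Complex.isPrimitiveRoot_exp r hr.ne').inv
  have h1 : ((Complex.exp (2 * Real.pi * Complex.I / r))⁻¹ ^ l) ^ t = 1 := by
    rw [pow_right_comm, hz.pow_eq_one_iff_dvd t |>.2 h, one_pow]
  exact (pow_eq_pow_mod j h1).symm

lemma aux_ram_sum (r t : ℕ) (hr : 1 < r) (h : r ∣ t) :
    ∑ j ∈ Finset.range t, ramanujanSum r (-(j : ℤ)) = 0 := by
  unfold ramanujanSum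
  rw [Finset.sum_comm]
  refine Finset.sum_eq_zero fun l hl => ?_
  simp only [aux_exp]
  have hz := (Complex.isPrimitiveRoot_exp r (by omega)).inv
  have h1 : ((Complex.exp (2 * Real.pi * Complex.I / r))⁻¹ ^ l) ^ t = 1 := by
    rw [pow_right_comm, hz.pow_eq_one_iff_dvd t |>.2 h, one_pow]
  have h2 : (Complex.exp (2 * Real.pi * Complex.I / r))⁻¹ ^ l ≠ 1 := by
    intro h3
    have h4 := (hz.pow_eq_one_iff_dvd l).1 h3
    have h5 := (Finset.mem_filter.1 hl).2
    have := Nat.Coprime.eq_one_of_dvd h5.symm h4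
    omega
  rw [geom_sum_eq h2, h1]; simp

lemma aux_ram_one (m : ℤ) : ramanujanSum 1 m = 1 := by
  have : (Finset.Icc 1 1).filter (fun l => Nat.Coprime l 1) = {1} := by
    ext; simp
  unfold ramanujanSum
  rw [this, Finset.sum_singleton, Complex.exp_eq_one_iff]
  exact ⟨m, by push_cast; ring⟩

/-- Suppose `n ≥ 2`, `q ≥ 2` and `gcd(q - 1, n) = 1`.  If for every conjugacy class of
`Sₙ` and every value `v`, with `t` the largest divisor of `n` with `gcd(v - 1, t) = 1`,
the permutations in the class with `cd = v` have major index equidistributed mod `t`,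
then the affine `q`-shuffle measure and the measure of a `q`-riffle shuffle followed by
a cut assign the same probability to every conjugacy class. -/
theorem affine_eq_cut_shuffle_on_classes (n q : ℕ) (hn : 2 ≤ n) (hq : 2 ≤ q)
    (hgcd : Nat.gcd (q - 1) n = 1)
    (hyp : ∀ (σ : Equiv.Perm (Fin n)) (v t : ℕ),
      t ∣ n → Int.gcd ((v : ℤ) - 1) (t : ℤ) = 1 →
      (∀ t' : ℕ, t' ∣ n → Int.gcd ((v : ℤ) - 1) (t' : ℤ) = 1 → t' ≤ t) →
      ∀ j₁ j₂ : ℕ,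
        (Finset.univ.filter (fun w : Equiv.Perm (Fin n) =>
            IsConj σ w ∧ numCyclicDescents w = v ∧ majIndex w % t = j₁ % t)).card
          = (Finset.univ.filter (fun w : Equiv.Perm (Fin n) =>
              IsConj σ w ∧ numCyclicDescents w = v ∧ majIndex w % t = j₂ % t)).card) :
    ∀ σ : Equiv.Perm (Fin n),
      ∑ w ∈ Finset.univ.filter (fun w : Equiv.Perm (Fin n) => IsConj σ w),
          affineShuffle n q w
        = ∑ w ∈ Finset.univ.filter (fun w : Equiv.Perm (Fin n) => IsConj σ w),
            (1 / ((n : ℂ) * (q : ℂ) ^ (n - 1)))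
              * (Nat.choose (n + q - numCyclicDescents w - 1) (n - 1) : ℂ) := by
  intro σ
  have hC : ∑ w ∈ Finset.univ.filter (fun w : Equiv.Perm (Fin n) => IsConj σ w),
          affineShuffle n q w = ∑ w ∈ Finset.univ.filter
            (fun w : Equiv.Perm (Fin n) => IsConj σ w), affineShuffle n q w⁻¹ := by
    have hinv : ∀ w : Equiv.Perm (Fin n), IsConj σ w → IsConj σ w⁻¹ := by
      intro w h
      rw [Equiv.Perm.isConj_iff_cycleType_eq] at h ⊢
      rw [Equiv.Perm.cycleType_inv, h]
    refine Finset.sum_nbij' (fun w => w⁻¹) (fun w => w⁻¹) ?_ ?_ ?_ ?_ ?_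
    · intro w hw
      exact Finset.mem_filter.2 ⟨Finset.mem_univ _, hinv w (Finset.mem_filter.1 hw).2⟩
    · intro w hw
      exact Finset.mem_filter.2 ⟨Finset.mem_univ _, hinv w (Finset.mem_filter.1 hw).2⟩
    · simp
    · simp
    · simp
  rw [hC]
  set C := Finset.univ.filter (fun w : Equiv.Perm (Fin n) => IsConj σ w) with hCdef
  rw [← Finset.sum_fiberwise_of_maps_to (s := C) (t := C.image numCyclicDescents)
      (g := numCyclicDescents) (fun w hw => Finset.mem_image_of_mem _ hw),
    ← Finset.sum_fiberwise_of_maps_to (s := C) (t := C.image numCyclicDescents)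
      (g := numCyclicDescents) (fun w hw => Finset.mem_image_of_mem _ hw)]
  refine Finset.sum_congr rfl fun v _ => ?_
  set S := C.filter (fun w => numCyclicDescents w = v) with hS
  have hSv : ∀ w ∈ S, numCyclicDescents w = v := fun w hw => (Finset.mem_filter.1 hw).2
  have hn0 : 0 < n := by omega
  obtain ⟨t, htn, htc, htm, htd⟩ := aux_t n hn0 ((v : ℤ) - 1)
  have ht0 : 0 < t := Nat.pos_of_dvd_of_pos htn hn0
  have key := aux_equi S majIndex t ht0 (by
    intro j₁ j₂
    have := hyp σ v t htn htc htm j₁ j₂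
    have hf : ∀ j : ℕ, S.filter (fun w => majIndex w % t = j % t) =
        Finset.univ.filter (fun w : Equiv.Perm (Fin n) =>
          IsConj σ w ∧ numCyclicDescents w = v ∧ majIndex w % t = j % t) := by
      intro j
      ext w
      rw [Finset.mem_filter, hS, Finset.mem_filter, hCdef, Finset.mem_filter, Finset.mem_filter]
      tauto
    rw [← hf, ← hf] at this
    exact this)
  have hqn : IsCoprime ((q : ℤ) - 1) (n : ℤ) := by
    have h1 : IsCoprime ((q - 1 : ℕ) : ℤ) (n : ℤ) := Nat.isCoprime_iff_coprime.2 hgcd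
    rwa [Nat.cast_sub (by omega), Nat.cast_one] at h1
  rcases lt_trichotomy v q with hv | hv | hv
  · have e1 : ∀ w ∈ S, affineShuffle n q w⁻¹ = (1 / ((n : ℂ) * (q : ℂ) ^ (n - 1))) *
      ∑ r ∈ (Nat.divisors n).filter (fun r => r ∣ q - v),
        (Nat.choose ((n + q - v - r) / r) ((q - v) / r) : ℂ)
          * ramanujanSum r (-(majIndex w : ℤ)) := by
      intro w hw
      unfold affineShuffle
      rw [inv_inv, hSv w hw, if_pos hv]
    have e2 : ∀ w ∈ S, (1 / ((n : ℂ) * (q : ℂ) ^ (n - 1)))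
              * (Nat.choose (n + q - numCyclicDescents w - 1) (n - 1) : ℂ) =
        (1 / ((n : ℂ) * (q : ℂ) ^ (n - 1))) * (Nat.choose (n + q - v - 1) (n - 1) : ℂ) := by
      intro w hw
      rw [hSv w hw]
    rw [Finset.sum_congr rfl e1, Finset.sum_congr rfl e2, ← Finset.mul_sum, ← Finset.mul_sum,
      Finset.sum_comm]
    congr 1
    rw [Finset.sum_eq_single 1]
    · refine Finset.sum_congr rfl fun w _ => ?_
      rw [aux_ram_one, mul_one, Nat.div_one, Nat.div_one]
      congr 1
      apply Nat.choose_symm_of_eq_add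
      omega
    · intro r hr hr1
      rw [← Finset.mul_sum]
      have hr' := Finset.mem_filter.1 hr
      have hrn : r ∣ n := Nat.dvd_of_mem_divisors hr'.1
      have hr0 : 0 < r := Nat.pos_of_dvd_of_pos hrn hn0
      have hrt : r ∣ t := by
        refine htd r hrn (Int.isCoprime_iff_gcd_eq_one.1 ?_)
        have h1 : IsCoprime ((q : ℤ) - 1) (r : ℤ) :=
          hqn.of_isCoprime_of_dvd_right (by exact_mod_cast hrn)
        obtain ⟨k, hk⟩ := hr'.2
        have h2 : (v : ℤ) - 1 = (q : ℤ) - 1 + (r : ℤ) * (-k) := by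
          have : (q : ℤ) = v + r * k := by
            have : q = v + r * k := by omega
            exact_mod_cast this
          rw [this]; ring
        rw [h2]
        exact h1.add_mul_left_left _
      rw [key (fun j => ramanujanSum r (-(j : ℤ))) (fun j => aux_ram_mod r t hr0 hrt j),
        aux_ram_sum r t (by omega) hrt, mul_zero, mul_zero]
    · intro h
      exact (h (Finset.mem_filter.2 ⟨Nat.one_mem_divisors.2 hn0.ne', one_dvd _⟩)).elim
  · subst hv
    have htn' : t = n := Nat.dvd_antisymm htn
      (htd n dvd_rfl (Int.isCoprime_iff_gcd_eq_one.1 hqn))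
    subst htn'
    have e1 : ∀ w ∈ S, affineShuffle t v w⁻¹ =
        (fun j : ℕ => if j % t = 0 then (1 : ℂ) / (v : ℂ) ^ (t - 1) else 0) (majIndex w) := by
      intro w hw
      unfold affineShuffle
      rw [inv_inv, hSv w hw, if_neg (lt_irrefl _)]
      simp
    have e2 : ∀ w ∈ S, (1 / ((t : ℂ) * (v : ℂ) ^ (t - 1)))
              * (Nat.choose (t + v - numCyclicDescents w - 1) (t - 1) : ℂ) =
        (fun _ : ℕ => 1 / ((t : ℂ) * (v : ℂ) ^ (t - 1))) (majIndex w) := by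
      intro w hw
      rw [hSv w hw, Nat.add_sub_cancel, Nat.choose_self]
      simp
    rw [Finset.sum_congr rfl e1, Finset.sum_congr rfl e2, 
      key (fun j : ℕ => if j % t = 0 then (1 : ℂ) / (v : ℂ) ^ (t - 1) else 0)
        (by intro j; simp only [Nat.mod_mod]),
      key (fun _ : ℕ => 1 / ((t : ℂ) * (v : ℂ) ^ (t - 1))) (fun _ => rfl)]
    congr 1
    rw [Finset.sum_eq_single 0]
    · have : (t : ℂ) ≠ 0 := by exact_mod_cast hn0.ne'
      have : (v : ℂ) ≠ 0 := by exact_mod_cast (by omega : v ≠ 0)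
      simp
      field_simp
    · intro j hj hj0
      rw [Nat.mod_eq_of_lt (Finset.mem_range.1 hj), if_neg hj0]
    · intro h
      exact absurd (Finset.mem_range.2 hn0) h
  · refine Finset.sum_congr rfl fun w hw => ?_
    unfold affineShuffle
    rw [inv_inv, hSv w hw, if_neg (by omega), if_neg (by omega),
      Nat.choose_eq_zero_of_lt (by omega)]
    simp
end

section
/- Let n ≥ 4. The transpositions w = (i,j) in S_n with exactly 2 cyclic descents are the n transpositions (i, i+1) for 1 ≤ i ≤ n−2, together with (1, n) and (n−1, n), and their major indices hit each residue class modulo n exactly once: for every residue c mod n, #{transpositions w ∈ S_n : cd(w) = 2 and maj(w) ≡ c mod n} = 1. -/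
open scoped Classical
theorem rot_val {n : ℕ} (i : Fin n) :
    ((finRotate n i : Fin n) : ℕ) = if (i : ℕ) + 1 < n then (i : ℕ) + 1 else 0 := by
  rcases n with _ | n
  · exact i.elim0
  · split_ifs with h
    · exact coe_finRotate_of_ne_last (by intro e; subst e; simp at h)
    · have : i = Fin.last n := by ext; simp; omega
      subst this
      simp

theorem swap_val {n : ℕ} (a b i : Fin n) :
    ((Equiv.swap a b i : Fin n) : ℕ) = if (i : ℕ) = a then (b : ℕ) else if (i : ℕ) = b then (a : ℕ) else i := by
  rw [Equiv.swap_apply_def]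
  simp only [← Fin.ext_iff]
  split_ifs <;> rfl

theorem desc_iff {n : ℕ} (hn : 4 ≤ n) (a b i : Fin n) (hab : (a : ℕ) < b) :
    (Equiv.swap a b (finRotate n i) < Equiv.swap a b i) ↔
      ((i : ℕ) = a ∨ (i : ℕ) + 1 = b ∨ ((i : ℕ) + 1 = n ∧ ¬ ((a : ℕ) = 0 ∧ (b : ℕ) + 1 = n))) := by
  rw [Fin.lt_def, swap_val, swap_val, rot_val]
  have := i.2
  have := a.2
  have := b.2
  split_ifs <;> omega

theorem cd_adj {n : ℕ} (hn : 4 ≤ n) (a b : Fin n) (hab : (a : ℕ) + 1 = b) :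
    numCyclicDescents (Equiv.swap a b) = 2 := by
  unfold numCyclicDescents
  rw [Finset.card_eq_two]
  refine ⟨a, ⟨n - 1, by omega⟩, ?_, ?_⟩
  · intro h
    have := congrArg Fin.val h
    have := b.2
    simp at *
    omega
  · ext i
    have := b.2
    have := i.2
    simp only [Finset.mem_filter, Finset.mem_univ, true_and, Finset.mem_insert,
      Finset.mem_singleton, desc_iff hn a b i (by omega), Fin.ext_iff]
    omega

theorem cd_ends {n : ℕ} (hn : 4 ≤ n) (a b : Fin n) (ha : (a : ℕ) = 0) (hb : (b : ℕ) + 1 = n) :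
    numCyclicDescents (Equiv.swap a b) = 2 := by
  unfold numCyclicDescents
  rw [Finset.card_eq_two]
  refine ⟨a, ⟨n - 2, by omega⟩, ?_, ?_⟩
  · intro h
    have := congrArg Fin.val h
    simp at *
    omega
  · ext i
    have := i.2
    simp only [Finset.mem_filter, Finset.mem_univ, true_and, Finset.mem_insert,
      Finset.mem_singleton, desc_iff hn a b i (by omega), Fin.ext_iff]
    omega

theorem cd_other {n : ℕ} (hn : 4 ≤ n) (a b : Fin n) (hab : (a : ℕ) + 1 < b)
    (h : ¬ ((a : ℕ) = 0 ∧ (b : ℕ) + 1 = n)) :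
    numCyclicDescents (Equiv.swap a b) = 3 := by
  unfold numCyclicDescents
  have := b.2
  rw [Finset.card_eq_three]
  refine ⟨a, ⟨b - 1, by omega⟩, ⟨n - 1, by omega⟩, ?_, ?_, ?_, ?_⟩
  · simp only [ne_eq, Fin.ext_iff]; omega
  · simp only [ne_eq, Fin.ext_iff]; omega
  · simp only [ne_eq, Fin.ext_iff]; omega
  · ext i
    have := i.2
    simp only [Finset.mem_filter, Finset.mem_univ, true_and, Finset.mem_insert,
      Finset.mem_singleton, desc_iff hn a b i (by omega), Fin.ext_iff]
    omega

theorem maj_adj {n : ℕ} (hn : 4 ≤ n) (a b : Fin n) (hab : (a : ℕ) + 1 = b) :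
    majIndex (Equiv.swap a b) = b := by
  unfold majIndex
  have : (Finset.univ.filter (fun i : Fin n => (i : ℕ) + 1 < n ∧
      Equiv.swap a b (finRotate n i) < Equiv.swap a b i)) = {a} := by
    ext i
    have := b.2
    simp only [Finset.mem_filter, Finset.mem_univ, true_and,
      Finset.mem_singleton, desc_iff hn a b i (by omega), Fin.ext_iff]
    omega
  rw [this, Finset.sum_singleton, hab]

theorem maj_ends {n : ℕ} (hn : 4 ≤ n) (a b : Fin n) (ha : (a : ℕ) = 0) (hb : (b : ℕ) + 1 = n) :
    majIndex (Equiv.swap a b) = n := by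
  unfold majIndex
  have : (Finset.univ.filter (fun i : Fin n => (i : ℕ) + 1 < n ∧
      Equiv.swap a b (finRotate n i) < Equiv.swap a b i)) = {a, ⟨n - 2, by omega⟩} := by
    ext i
    have := i.2
    simp only [Finset.mem_filter, Finset.mem_univ, true_and, Finset.mem_insert,
      Finset.mem_singleton, desc_iff hn a b i (by omega), Fin.ext_iff]
    omega
  rw [this, Finset.sum_pair (by simp only [ne_eq, Fin.ext_iff]; omega)]
  simp only
  omega

theorem main_iff {n : ℕ} (hn : 4 ≤ n) (w : Equiv.Perm (Fin n)) :
    (w.IsSwap ∧ numCyclicDescents w = 2) ↔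
      ∃ a b : Fin n, w = Equiv.swap a b ∧
        ((a : ℕ) + 1 = b ∨ ((a : ℕ) = 0 ∧ (b : ℕ) + 1 = n)) := by
  constructor
  · rintro ⟨⟨x, y, hxy, rfl⟩, h⟩
    have key : ∀ a b : Fin n, (a : ℕ) < b → numCyclicDescents (Equiv.swap a b) = 2 →
        ((a : ℕ) + 1 = b ∨ ((a : ℕ) = 0 ∧ (b : ℕ) + 1 = n)) := by
      intro a b hab h
      by_contra hc
      have := cd_other hn a b (by omega) (by omega)
      omega
    rcases lt_or_gt_of_ne hxy with hl | hl
    · exact ⟨x, y, rfl, key x y hl h⟩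
    · rw [Equiv.swap_comm] at h
      exact ⟨y, x, Equiv.swap_comm _ _, key y x hl h⟩
  · rintro ⟨a, b, rfl, h⟩
    refine ⟨⟨a, b, ?_, rfl⟩, ?_⟩
    · simp only [ne_eq, Fin.ext_iff]; omega
    · rcases h with h | h
      · exact cd_adj hn a b h
      · exact cd_ends hn a b h.1 h.2

/-- For `n ≥ 4`, the transpositions in `Sₙ` with exactly `2` cyclic descents are exactly
the `(i, i+1)` for `1 ≤ i ≤ n-2` (0-based: `(i-1, i)`), together with `(1, n)` (0-based
`(0, n-1)`) and `(n-1, n)` (0-based `(n-2, n-1)`), and their major indices hit each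
residue class modulo `n` exactly once. -/
theorem transpositions_two_cyclic_descents (n : ℕ) (hn : 4 ≤ n) :
    (∀ w : Equiv.Perm (Fin n),
        (w.IsSwap ∧ numCyclicDescents w = 2) ↔
          ((∃ i : ℕ, ∃ _h1 : 1 ≤ i, ∃ _h2 : i ≤ n - 2,
              w = Equiv.swap ⟨i - 1, by omega⟩ ⟨i, by omega⟩)
            ∨ w = Equiv.swap ⟨0, by omega⟩ ⟨n - 1, by omega⟩
            ∨ w = Equiv.swap ⟨n - 2, by omega⟩ ⟨n - 1, by omega⟩))
      ∧ (∀ c : ℕ,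
          (Finset.univ.filter (fun w : Equiv.Perm (Fin n) =>
              w.IsSwap ∧ numCyclicDescents w = 2 ∧ majIndex w % n = c % n)).card = 1) := by
  constructor
  · intro w
    rw [main_iff hn]
    constructor
    · rintro ⟨a, b, rfl, h⟩
      have hb := b.2
      rcases h with h | ⟨h, h'⟩
      · by_cases hbn : (b : ℕ) ≤ n - 2
        · left
          refine ⟨b, by omega, hbn, ?_⟩
          congr 1
          ext
          simp only
          omega
        · right; right
          congr 1 <;> ext <;> simp only <;> omega
      · right; left
        congr 1 <;> ext <;> simp only <;> omega
    · rintro (⟨i, h1, h2, rfl⟩ | rfl | rfl)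
      · exact ⟨_, _, rfl, Or.inl (by simp only; omega)⟩
      · exact ⟨_, _, rfl, Or.inr ⟨rfl, Nat.sub_add_cancel (by omega)⟩⟩
      · exact ⟨_, _, rfl, Or.inl (by simp only; omega)⟩
  · intro c
    have hr : c % n < n := Nat.mod_lt _ (by omega)
    generalize c % n = r at hr
    have hex : ∃ a b : Fin n, ((a : ℕ) + 1 = b ∧ (b : ℕ) = r) ∨
        ((a : ℕ) = 0 ∧ (b : ℕ) + 1 = n ∧ r = 0) := by
      by_cases h : r = 0
      · exact ⟨⟨0, by omega⟩, ⟨n - 1, by omega⟩, Or.inr ⟨rfl, Nat.sub_add_cancel (by omega), h⟩⟩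
      · exact ⟨⟨r - 1, by omega⟩, ⟨r, hr⟩, Or.inl ⟨Nat.sub_add_cancel (by omega), rfl⟩⟩
    obtain ⟨a, b, hab⟩ := hex
    rw [Finset.card_eq_one]
    refine ⟨Equiv.swap a b, ?_⟩
    ext w
    simp only [Finset.mem_filter, Finset.mem_univ, true_and, Finset.mem_singleton]
    rw [← and_assoc, main_iff hn]
    constructor
    · rintro ⟨⟨x, y, rfl, h⟩, hm⟩
      have hy := y.2
      have hxy : x = a ∧ y = b := by
        simp only [Fin.ext_iff]
        rcases h with h | h
        · rw [maj_adj hn x y h, Nat.mod_eq_of_lt hy] at hm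
          omega
        · rw [maj_ends hn x y h.1 h.2, Nat.mod_self] at hm
          omega
      rw [hxy.1, hxy.2]
    · rintro rfl
      refine ⟨⟨a, b, rfl, by omega⟩, ?_⟩
      rcases hab with h | h
      · rw [maj_adj hn a b h.1, Nat.mod_eq_of_lt b.2, h.2]
      · rw [maj_ends hn a b h.1 h.2.1, Nat.mod_self, h.2.2]
end
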